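/- For every finite subset S ⊆ G with 1 ∉ S, there exists a group homomorphism κ: G → G such that κ(h) = h for all h ∈ H, κ(G) = H, and 1 ∉ κ(S). -/

import Mathlib

/-- Generators of the group `K`: tree vertices `(n,τ)`, the letter `a`, and letters `bᵢ`. -/
inductive KGen : Type
  | vert : ℕ → List ℤ → KGen
  | a : KGen
  | b : ℤ → KGen
  deriving DecidableEq

/-- The parent `(n,τ)⁻` of a vertex `(n,τ)` of the tree `T`. -/
def parent : ℕ → List ℤ → ℕ × List ℤ
  | n, [] => (n + 1, [])
  | n, τ => (n, τ.dropLast)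

/-- Words over an alphabet `α` (a letter together with `true` for the letter itself,
`false` for its formal inverse). -/
abbrev Word (α : Type) := List (α × Bool)

/-- The word `u(x,y) = x y x² y x³ y ⋯ x¹⁰⁰ y`. -/
def uWord {α : Type} (x y : α) : Word α :=
  (List.range 100).flatMap fun k => List.replicate (k + 1) (x, true) ++ [(y, true)]

/-- The relator words of the presentation of `K`:
`u((n,τ),a) ((n,τ)⁻)⁻¹` and `u((n,τ),bᵢ) ((n,τ⌢⟨i⟩))⁻¹`. -/
def KRelWords : Set (Word KGen) :=
  { w | (∃ (n : ℕ) (τ : List ℤ), w = uWord (KGen.vert n τ) KGen.a ++ [(KGen.vert (parent n τ).1 (parent n τ).2, false)]) ∨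
        (∃ (n : ℕ) (τ : List ℤ) (i : ℤ), w = uWord (KGen.vert n τ) (KGen.b i) ++ [(KGen.vert n (τ ++ [i]), false)]) }

/-- The relators of `K` as elements of the free group. -/
def KRels : Set (FreeGroup KGen) := FreeGroup.mk '' KRelWords

/-- The group `K`. -/
abbrev K := PresentedGroup KRels

/-- Generators of `G`: the generators of `K` together with the stable letter `t = none`. -/
abbrev GGen := Option KGen

/-- The relator words of the presentation of `G = ⟨K, t ∣ t bᵢ t⁻¹ = b_{i+1}⟩`:
the relators of `K` together with `t bᵢ t⁻¹ b_{i+1}⁻¹`. -/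
def GRelWords : Set (Word GGen) :=
  (fun w : Word KGen => w.map fun p => (some p.1, p.2)) '' KRelWords ∪
    { w | ∃ i : ℤ, w = [((none : GGen), true), (some (KGen.b i), true), ((none : GGen), false),
        (some (KGen.b (i + 1)), false)] }

/-- The relators of `G` as elements of the free group. -/
def GRels : Set (FreeGroup GGen) := FreeGroup.mk '' GRelWords

/-- The group `G`, the HNN extension of `K` along `bᵢ ↦ b_{i+1}`. -/
abbrev G := PresentedGroup GRels

/-- The vertex `(n,τ)` as an element of `G`. -/
def gvert (n : ℕ) (τ : List ℤ) : G := PresentedGroup.of (some (KGen.vert n τ))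

/-- `a` as an element of `G`. -/
def ga : G := PresentedGroup.of (some KGen.a)

/-- `bᵢ` as an element of `G`. -/
def gb (i : ℤ) : G := PresentedGroup.of (some (KGen.b i))

/-- The stable letter `t` as an element of `G`. -/
def gt' : G := PresentedGroup.of (none : GGen)

/-- The subgroup `H` of `G` generated by `(1,⟨⟩)`, `a`, `b₀` and `t`. -/
def H : Subgroup G := Subgroup.closure {gvert 1 [], ga, gb 0, gt'}

open Monoid

/-- The group word `x y x² y ⋯ x¹⁰⁰ y`. -/
def uElt {A : Type*} [Monoid A] (x y : A) : A :=
  ((List.range 100).map fun k => x ^ (k + 1) * y).prod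

theorem map_uElt {A B : Type*} [Monoid A] [Monoid B] (f : A →* B) (x y : A) :
    f (uElt x y) = uElt (f x) (f y) := by
  have h : (f ∘ fun k : ℕ => x ^ (k + 1) * y) = fun k => f x ^ (k + 1) * f y := by
    funext k
    rw [Function.comp_apply, map_mul, map_pow]
  rw [uElt, uElt, map_list_prod, List.map_map, h]

/-! ### Normal forms in the free product `ℤ ∗ ℤ` -/

/-- The free product `ℤ ∗ ℤ`; the factor `false` is generated by `x`, the factor `true` by `y`. -/
abbrev ZZ := CoprodI (fun _ : Bool => Multiplicative ℤ)

namespace ZZ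

/-- The syllable `xⁿ` (for `b = false`) or `yⁿ` (for `b = true`). -/
def syl (b : Bool) (n : ℤ) : ZZ := CoprodI.of (i := b) (Multiplicative.ofAdd n)

theorem syl_zero (b : Bool) : syl b 0 = 1 := by simp [syl]

theorem syl_mul (b : Bool) (m n : ℤ) : syl b m * syl b n = syl b (m + n) := by
  simp [syl, ← map_mul, ofAdd_add]

theorem syl_mul_assoc (b : Bool) (m n : ℤ) (g : ZZ) :
    syl b m * (syl b n * g) = syl b (m + n) * g := by
  rw [← mul_assoc, syl_mul]

theorem syl_inv (b : Bool) (n : ℤ) : (syl b n)⁻¹ = syl b (-n) := by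
  simp [syl, ← map_inv, ofAdd_neg]

theorem syl_pow (b : Bool) (n : ℤ) (k : ℕ) : syl b n ^ k = syl b (k * n) := by
  simp [syl, ← map_pow, ← ofAdd_nsmul]

theorem syl_zpow (b : Bool) (n k : ℤ) : syl b n ^ k = syl b (k * n) := by
  rw [syl, ← map_zpow, ← ofAdd_zsmul, smul_eq_mul, syl]

theorem hom_ext {A : Type*} [Monoid A] {f g : ZZ →* A}
    (h : ∀ b, f (syl b 1) = g (syl b 1)) : f = g :=
  CoprodI.ext_hom _ _ fun b => MonoidHom.ext_mint (h b)

/-- The homomorphism `ℤ ∗ ℤ → A` sending `x` and `y` to given elements. -/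
def lift {A : Type*} [Group A] (x y : A) : ZZ →* A :=
  CoprodI.lift fun b => zpowersHom A (bif b then y else x)

theorem lift_syl {A : Type*} [Group A] (x y : A) (b : Bool) (n : ℤ) :
    lift x y (syl b n) = (bif b then y else x) ^ n := by
  simp [lift, syl]

/-- `g` is trivial or its normal form starts with a syllable from the factor `b`. -/
def Starts (b : Bool) (g : ZZ) : Prop :=
  ∃ w : CoprodI.Word (fun _ : Bool => Multiplicative ℤ), w.prod = g ∧ w.fstIdx ≠ some (!b)

theorem starts_one (b : Bool) : Starts b 1 :=
  ⟨.empty, by simp, by simp [CoprodI.Word.fstIdx, CoprodI.Word.empty]⟩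

theorem Starts.syl_mul {b : Bool} {g : ZZ} (hg : Starts (!b) g) {n : ℤ} (hn : n ≠ 0) :
    Starts b (syl b n * g) := by
  obtain ⟨w, rfl, hw⟩ := hg
  refine ⟨.cons (Multiplicative.ofAdd n) w (by simpa using hw) (by simpa using hn), ?_, ?_⟩
  · rw [CoprodI.Word.prod_cons, syl]
  · simp [CoprodI.Word.fstIdx_cons]

theorem Starts.syl_mul_ne {b : Bool} {g : ZZ} (hg : Starts (!b) g) {n : ℤ} (hn : n ≠ 0) :
    syl b n * g ≠ 1 := by
  obtain ⟨w, rfl, hw⟩ := hg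
  intro h
  have : CoprodI.Word.cons (i := b) (Multiplicative.ofAdd n) w (by simpa using hw)
      (by simpa using hn) = CoprodI.Word.empty := by
    apply CoprodI.Word.equiv.symm.injective
    change CoprodI.Word.prod _ = CoprodI.Word.prod _
    rw [CoprodI.Word.prod_cons, CoprodI.Word.prod_empty]
    exact h
  simpa [CoprodI.Word.fstIdx, CoprodI.Word.cons, CoprodI.Word.empty] using
    congrArg CoprodI.Word.fstIdx this

theorem starts_x {g : ZZ} (hg : Starts true g) {n : ℤ} (hn : n ≠ 0) :
    Starts false (syl false n * g) := Starts.syl_mul (b := false) hg hn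

theorem starts_y {g : ZZ} (hg : Starts false g) {n : ℤ} (hn : n ≠ 0) :
    Starts true (syl true n * g) := Starts.syl_mul (b := true) hg hn

theorem starts_syl (b : Bool) (n : ℤ) : Starts b (syl b n) := by
  rcases eq_or_ne n 0 with rfl | hn
  · rw [syl_zero]; exact starts_one b
  · simpa using Starts.syl_mul (starts_one (!b)) hn

/-- The initial segment `x y x² y` of `u(x, y)`. -/
def pre (c : ZZ) : ZZ := syl false 1 * (syl true 1 * (syl false 2 * (syl true 1 * c)))

/-- The middle segment `x³ y ⋯ x⁹⁸ y` of `u(x, y)`. -/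
def core : ZZ := ((List.range' 2 96).map fun k => syl false 1 ^ (k + 1) * syl true 1).prod

/-- The final segment `x⁹⁹ y x¹⁰⁰` of `u(x, y) y⁻¹`. -/
def post (c : ZZ) : ZZ := syl false 99 * (syl true 1 * (syl false 100 * c))

/-- The inverse of `pre`. -/
def preInv (c : ZZ) : ZZ :=
  syl true (-1) * (syl false (-2) * (syl true (-1) * (syl false (-1) * c)))

/-- The inverse of `post`. -/
def postInv (c : ZZ) : ZZ := syl false (-100) * (syl true (-1) * (syl false (-99) * c))

/-- The element `q = u(x, y) y⁻¹`. -/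
def q : ZZ := uElt (syl false 1) (syl true 1) * syl true (-1)

theorem q_mul (c : ZZ) : q * c = pre (core * post c) := by
  have : List.range 100 = [0, 1] ++ List.range' 2 96 ++ [98, 99] := by decide
  rw [q, uElt, this]
  simp only [List.map_append, List.prod_append, pre, post, core, List.map_cons, List.map_nil,
    List.prod_cons, List.prod_nil, syl_pow, mul_assoc, syl_mul_assoc, mul_one]
  norm_num [syl_zero]

theorem pre_preInv (c : ZZ) : pre (preInv c) = c := by
  simp [pre, preInv, syl_mul_assoc, syl_zero]

theorem post_postInv (c : ZZ) : post (postInv c) = c := by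
  simp [post, postInv, syl_mul_assoc, syl_zero]

theorem q_inv_mul (c : ZZ) : q⁻¹ * c = postInv (core⁻¹ * preInv c) := by
  rw [inv_mul_eq_iff_eq_mul, q_mul, post_postInv, mul_inv_cancel_left, pre_preInv]

theorem starts_core_mul {c : ZZ} (hc : Starts false c) : Starts false (core * c) := by
  unfold core
  generalize List.range' 2 96 = l
  induction l with
  | nil => simpa
  | cons k l ih =>
    rw [List.map_cons, List.prod_cons, mul_assoc, mul_assoc, syl_pow]
    refine starts_x (starts_y ih one_ne_zero) ?_
    push_cast
    omega

theorem starts_core_inv_mul {c : ZZ} (hc : Starts true c) : Starts true (core⁻¹ * c) := by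
  unfold core
  generalize List.range' 2 96 = l
  induction l generalizing c with
  | nil => simpa
  | cons k l ih =>
    rw [List.map_cons, List.prod_cons, syl_pow]
    simp only [mul_inv_rev, mul_assoc, syl_inv]
    have h : -(((k + 1 : ℕ) : ℤ) * 1) ≠ 0 := by
      push_cast
      omega
    exact ih (starts_y (starts_x hc h) (by norm_num))

/-- Elements whose normal form starts with the initial segment of `q`. -/
def YPos (g : ZZ) : Prop := ∃ c, Starts false c ∧ g = pre c

/-- Elements whose normal form starts with the initial segment of `q⁻¹`. -/
def YNeg (g : ZZ) : Prop := ∃ c, Starts true c ∧ g = postInv c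

/-- Elements `xⁿ yˡ e` with `n ≠ 0` and `e` trivial or starting like a power of `q`. -/
def X0 (g : ZZ) : Prop :=
  ∃ n l e, n ≠ 0 ∧ (e = 1 ∨ YPos e ∨ YNeg e) ∧ g = syl false n * (syl true l * e)

/-- Elements that can be multiplied by `q` or `q⁻¹` with little cancellation. -/
def Adm (g : ZZ) : Prop :=
  (∃ k z, (z = 1 ∨ X0 z) ∧ g = syl true k * z) ∨
    ∃ k z, k ≠ 0 ∧ (YPos z ∨ YNeg z) ∧ g = syl true k * z

theorem starts_of_Y {e : ZZ} (he : e = 1 ∨ YPos e ∨ YNeg e) : Starts false e := by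
  rcases he with rfl | ⟨c, hc, rfl⟩ | ⟨c, hc, rfl⟩
  · exact starts_one _
  · exact starts_x (starts_y (starts_x (starts_y hc (by norm_num)) (by norm_num)) (by norm_num))
      (by norm_num)
  · exact starts_x (starts_y (starts_x hc (by norm_num)) (by norm_num)) (by norm_num)

theorem starts_post₀ {c : ZZ} (hc : Starts true c) : Starts false (post c) :=
  starts_x (starts_y (starts_x hc (by norm_num)) (by norm_num)) (by norm_num)

theorem starts_post₁ {c : ZZ} (hc : Starts true c) {s : ℤ} (hs : s ≠ -100) :
    Starts false (post (syl false s * c)) := by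
  rw [post, syl_mul_assoc]
  exact starts_x (starts_y (starts_x hc (by omega)) (by norm_num)) (by norm_num)

theorem starts_post₂ {c : ZZ} (hc : Starts false c) (s : ℤ) {t : ℤ} (ht : t ≠ 0) (ht' : t ≠ -1) :
    Starts false (post (syl false s * (syl true t * c))) := by
  by_cases hs : s = -100
  · subst hs
    simp only [post, syl_mul_assoc, add_neg_cancel, syl_zero, one_mul]
    exact starts_x (starts_y hc (by omega)) (by norm_num)
  · exact starts_post₁ (starts_y hc ht) hs

theorem starts_post₃ {c : ZZ} (hc : Starts true c) (s : ℤ) {t v : ℤ} (ht : t ≠ 0) (hv : v ≠ 0)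
    (hv' : v ≠ -99) : Starts false (post (syl false s * (syl true t * (syl false v * c)))) := by
  by_cases hs : s = -100 ∧ t = -1
  · obtain ⟨rfl, rfl⟩ := hs
    simp only [post, syl_mul_assoc, add_neg_cancel, syl_zero, one_mul]
    exact starts_x hc (by omega)
  · by_cases h : t = -1
    · exact starts_post₁ (starts_y (starts_x hc hv) ht) (by tauto)
    · exact starts_post₂ (starts_x hc hv) s ht h

theorem starts_preInv₀ {c : ZZ} (hc : Starts true c) : Starts true (preInv c) :=
  starts_y (starts_x (starts_y (starts_x hc (by norm_num)) (by norm_num)) (by norm_num))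
    (by norm_num)

theorem starts_preInv₁ {c : ZZ} (hc : Starts true c) {s : ℤ} (hs : s ≠ 1) :
    Starts true (preInv (syl false s * c)) := by
  rw [preInv, syl_mul_assoc (n := s)]
  exact starts_y (starts_x (starts_y (starts_x hc (by omega)) (by norm_num)) (by norm_num))
    (by norm_num)

theorem starts_preInv₂ {c : ZZ} (hc : Starts false c) (s : ℤ) {t : ℤ} (ht : t ≠ 0) (ht' : t ≠ 1) :
    Starts true (preInv (syl false s * (syl true t * c))) := by
  by_cases hs : s = 1
  · subst hs
    simp only [preInv, syl_mul_assoc, neg_add_cancel, syl_zero, one_mul]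
    exact starts_y (starts_x (starts_y hc (by omega)) (by norm_num)) (by norm_num)
  · exact starts_preInv₁ (starts_y hc ht) hs

theorem starts_preInv₃ {c : ZZ} (hc : Starts true c) (s : ℤ) {t v : ℤ} (ht : t ≠ 0) (hv : v ≠ 0)
    (hv' : v ≠ 2) : Starts true (preInv (syl false s * (syl true t * (syl false v * c)))) := by
  by_cases hs : s = 1 ∧ t = 1
  · obtain ⟨rfl, rfl⟩ := hs
    simp only [preInv, syl_mul_assoc, neg_add_cancel, syl_zero, one_mul]
    exact starts_y (starts_x hc (by omega)) (by norm_num)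
  · by_cases h : t = 1
    · exact starts_preInv₁ (starts_y (starts_x hc hv) ht) (by tauto)
    · exact starts_preInv₂ (starts_x hc hv) s ht h

/-- `g` cancels against neither the end of `q` nor the end of `q⁻¹` completely. -/
def Good (g : ZZ) : Prop := Starts false (post g) ∧ Starts true (preInv g)

theorem good₀ {c : ZZ} (hc : Starts true c) : Good c := ⟨starts_post₀ hc, starts_preInv₀ hc⟩

theorem good₁ {c : ZZ} (hc : Starts true c) {s : ℤ} (hs : s ≠ -100) (hs' : s ≠ 1) :
    Good (syl false s * c) := ⟨starts_post₁ hc hs, starts_preInv₁ hc hs'⟩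

theorem good₃ {c : ZZ} (hc : Starts true c) (s : ℤ) {t v : ℤ} (ht : t ≠ 0) (hv : v ≠ 0)
    (hv' : v ≠ -99) (hv'' : v ≠ 2) : Good (syl false s * (syl true t * (syl false v * c))) :=
  ⟨starts_post₃ hc s ht hv hv', starts_preInv₃ hc s ht hv hv''⟩

theorem starts_pre_tail {c : ZZ} (hc : Starts false c) :
    Starts true (syl true 1 * (syl false 2 * (syl true 1 * c))) :=
  starts_y (starts_x (starts_y hc (by norm_num)) (by norm_num)) (by norm_num)

theorem starts_postInv_tail {c : ZZ} (hc : Starts true c) :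
    Starts true (syl true (-1) * (syl false (-99) * c)) :=
  starts_y (starts_x hc (by norm_num)) (by norm_num)

/-- `yᵏ c` is good if `c` starts with an `x`-syllable and is itself good. -/
theorem good_syl_mul {c : ZZ} (hc : Starts false c) (hg : Good c) (k : ℤ) :
    Good (syl true k * c) := by
  rcases eq_or_ne k 0 with rfl | hk
  · simpa [syl_zero] using hg
  · exact good₀ (starts_y hc hk)

theorem Adm.good {z : ZZ} (hz : Adm z) : Good z := by
  rcases hz with ⟨k, z, rfl | ⟨n, l, e, hn, he, rfl⟩, rfl⟩ | ⟨k, z, hk, hz, rfl⟩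
  · simpa using good₀ (starts_syl true k)
  · rcases eq_or_ne l 0 with rfl | hl
    · rw [syl_zero, one_mul]
      rcases he with rfl | ⟨c, hc, rfl⟩ | ⟨c, hc, rfl⟩
      · rcases eq_or_ne k 0 with rfl | hk
        · rw [syl_zero, one_mul]
          by_cases h1 : n = -100
          · subst h1
            refine ⟨?_, starts_preInv₁ (starts_one _) (by norm_num)⟩
            simp only [post, syl_mul_assoc]
            norm_num [syl_zero]
            exact starts_x (starts_syl true 1) (by norm_num)
          · refine ⟨starts_post₁ (starts_one _) h1, ?_⟩
            by_cases h2 : n = 1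
            · subst h2
              simp only [preInv, syl_mul_assoc]
              norm_num [syl_zero]
              exact starts_y (starts_x (starts_syl true (-1)) (by norm_num)) (by norm_num)
            · exact starts_preInv₁ (starts_one _) h2
        · exact good₀ (starts_y (starts_x (starts_one _) hn) hk)
      · rw [pre, syl_mul_assoc]
        by_cases h : n + 1 = 0
        · rw [h, syl_zero, one_mul, syl_mul_assoc]
          rcases eq_or_ne (k + 1) 0 with h' | h'
          · rw [h', syl_zero, one_mul]
            exact good₁ (starts_y hc (by norm_num)) (by norm_num) (by norm_num)
          · exact good₀ (starts_y (starts_x (starts_y hc (by norm_num)) (by norm_num)) h')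
        · refine good_syl_mul (starts_x (starts_pre_tail hc) h) ⟨?_, ?_⟩ k
          · exact starts_post₂ (starts_x (starts_y hc (by norm_num)) (by norm_num)) _
              (by norm_num) (by norm_num)
          · exact starts_preInv₁ (starts_pre_tail hc) (by omega)
      · rw [postInv, syl_mul_assoc]
        by_cases h : n + -100 = 0
        · rw [h, syl_zero, one_mul, syl_mul_assoc]
          rcases eq_or_ne (k + -1) 0 with h' | h'
          · rw [h', syl_zero, one_mul]
            exact good₁ hc (by norm_num) (by norm_num)
          · exact good₀ (starts_y (starts_x hc (by norm_num)) h')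
        · refine good_syl_mul (starts_x (starts_postInv_tail hc) h) ⟨?_, ?_⟩ k
          · exact starts_post₁ (starts_postInv_tail hc) (by omega)
          · exact starts_preInv₂ (starts_x hc (by norm_num)) _ (by norm_num) (by norm_num)
    · refine good_syl_mul (starts_x (starts_y (starts_of_Y he) hl) hn) ?_ k
      rcases he with rfl | ⟨c, hc, rfl⟩ | ⟨c, hc, rfl⟩
      · by_cases h : l = -1
        · subst h
          refine ⟨?_, starts_preInv₂ (starts_one _) _ (by norm_num) (by norm_num)⟩
          by_cases h' : n = -100
          · subst h'
            simp only [post, syl_mul_assoc]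
            norm_num [syl_zero, syl_mul]
            exact starts_syl false 99
          · exact starts_post₁ (starts_y (starts_one _) hl) h'
        · refine ⟨starts_post₂ (starts_one _) _ hl h, ?_⟩
          by_cases h' : n = 1
          · subst h'
            simp only [preInv, syl_mul_assoc]
            norm_num [syl_zero, syl_mul, syl_mul_assoc]
            by_cases h2 : l = 1
            · subst h2
              norm_num [syl_zero]
              exact starts_y (starts_syl false _) (by norm_num)
            · exact starts_y (starts_x (starts_syl true _) (by norm_num)) (by norm_num)
          · exact starts_preInv₁ (starts_y (starts_one _) hl) h'
      · exact good₃ (starts_pre_tail hc) _ hl (by norm_num) (by norm_num) (by norm_num)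
      · exact good₃ (starts_postInv_tail hc) _ hl (by norm_num) (by norm_num) (by norm_num)
  · exact good₀ (starts_y (starts_of_Y (.inr hz)) hk)

/-! ### The endomorphism of `ℤ ∗ ℤ` with `x ↦ u(x, y)`, `y ↦ y` -/

/-- Elements whose normal form starts like a nontrivial power of `q`. -/
def Y (g : ZZ) : Prop := YPos g ∨ YNeg g

theorem YPos.starts_post {g : ZZ} : YPos g → Starts false (post g) := by
  rintro ⟨c, hc, rfl⟩
  exact starts_post₁ (starts_pre_tail hc) (by norm_num)

theorem YNeg.starts_preInv {g : ZZ} : YNeg g → Starts true (preInv g) := by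
  rintro ⟨c, hc, rfl⟩
  exact starts_preInv₁ (starts_postInv_tail hc) (by norm_num)

theorem YPos_q_mul {g : ZZ} (hg : Starts false (post g)) : YPos (q * g) :=
  ⟨_, starts_core_mul hg, q_mul g⟩

theorem YNeg_q_inv_mul {g : ZZ} (hg : Starts true (preInv g)) : YNeg (q⁻¹ * g) :=
  ⟨_, starts_core_inv_mul hg, q_inv_mul g⟩

theorem Y_q_zpow_mul {z : ZZ} (hz : Adm z) {n : ℤ} (hn : n ≠ 0) : Y (q ^ n * z) := by
  have hpos (k : ℕ) : YPos (q ^ (k + 1) * z) := by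
    induction k with
    | zero => simpa using YPos_q_mul hz.good.1
    | succ k ih => rw [pow_succ', mul_assoc]; exact YPos_q_mul ih.starts_post
  have hneg (k : ℕ) : YNeg (q⁻¹ ^ (k + 1) * z) := by
    induction k with
    | zero => simpa using YNeg_q_inv_mul hz.good.2
    | succ k ih => rw [pow_succ', mul_assoc]; exact YNeg_q_inv_mul ih.starts_preInv
  obtain ⟨k, rfl | rfl⟩ := n.eq_nat_or_neg
  · obtain ⟨j, rfl⟩ := Nat.exists_eq_succ_of_ne_zero (n := k) (by simpa using hn)
    left
    rw [zpow_natCast]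
    exact hpos j
  · obtain ⟨j, rfl⟩ := Nat.exists_eq_succ_of_ne_zero (n := k) (by simpa using hn)
    right
    rw [zpow_neg, ← inv_zpow, zpow_natCast]
    exact hneg j

/-- The endomorphism with `x ↦ q`, `y ↦ y`. -/
def θ' : ZZ →* ZZ := lift q (syl true 1)

theorem θ'_x (n : ℤ) : θ' (syl false n) = q ^ n := lift_syl _ _ _ _

theorem θ'_y (n : ℤ) : θ' (syl true n) = syl true n := by
  rw [θ', lift_syl, cond_true, syl_zpow, mul_one]

theorem θ'_mul_aux {z : ZZ} (hz : z = 1 ∨ X0 z)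
    (w : CoprodI.Word (fun _ : Bool => Multiplicative ℤ)) :
    (w.fstIdx = some false ∧ Y (θ' w.prod * z)) ∨ (∃ k, w.prod = syl true k) ∨
      (w.fstIdx = some true ∧ ∃ k g, k ≠ 0 ∧ Y g ∧ θ' w.prod * z = syl true k * g) := by
  induction w using CoprodI.Word.consRecOn with
  | empty => exact .inr (.inl ⟨0, by rw [CoprodI.Word.prod_empty, syl_zero]⟩)
  | cons i m w h1 h2 ih =>
    obtain ⟨n, rfl⟩ := Multiplicative.ofAdd.surjective m
    have hn : n ≠ 0 := by simpa using h2
    have hp : CoprodI.of (M := fun _ : Bool => Multiplicative ℤ) (i := i) (Multiplicative.ofAdd n) =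
        syl i n := rfl
    rw [CoprodI.Word.prod_cons, CoprodI.Word.fstIdx_cons, hp, map_mul, mul_assoc]
    cases i
    · refine .inl ⟨rfl, ?_⟩
      rw [θ'_x]
      refine Y_q_zpow_mul ?_ hn
      rcases ih with ⟨h, -⟩ | ⟨k, hk⟩ | ⟨-, k, g, hk, hg, h⟩
      · exact absurd h h1
      · rw [hk, θ'_y]
        exact .inl ⟨k, z, hz, rfl⟩
      · rw [h]
        exact .inr ⟨k, g, hk, hg, rfl⟩
    · rcases ih with ⟨-, h⟩ | ⟨k, hk⟩ | ⟨h, -⟩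
      · exact .inr (.inr ⟨rfl, n, _, hn, h, by rw [θ'_y]⟩)
      · exact .inr (.inl ⟨n + k, by rw [hk, syl_mul]⟩)
      · exact absurd h h1

theorem θ'_mul {z : ZZ} (hz : z = 1 ∨ X0 z) (m : ZZ) :
    (∃ k, m = syl true k) ∨ ∃ k g, Y g ∧ θ' m * z = syl true k * g := by
  obtain ⟨w, rfl⟩ := (CoprodI.Word.equiv (M := fun _ : Bool => Multiplicative ℤ)).symm.surjective m
  change (∃ k, w.prod = _) ∨ ∃ k g, Y g ∧ θ' w.prod * z = _
  rcases θ'_mul_aux hz w with ⟨-, h⟩ | h | ⟨-, k, g, -, hg, h⟩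
  · exact .inr ⟨0, _, h, by rw [syl_zero, one_mul]⟩
  · exact .inl h
  · exact .inr ⟨k, g, hg, h⟩

theorem syl_ne_one (b : Bool) {n : ℤ} (hn : n ≠ 0) : syl b n ≠ 1 := by
  simpa using Starts.syl_mul_ne (starts_one (!b)) hn

theorem Y.syl_mul_ne_one {g : ZZ} (hg : Y g) (k : ℤ) : syl true k * g ≠ 1 := by
  rcases eq_or_ne k 0 with rfl | hk
  · rw [syl_zero, one_mul]
    rcases hg with ⟨c, hc, rfl⟩ | ⟨c, hc, rfl⟩
    · exact Starts.syl_mul_ne (b := false) (starts_pre_tail hc) (by norm_num)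
    · exact Starts.syl_mul_ne (b := false) (starts_postInv_tail hc) (by norm_num)
  · exact Starts.syl_mul_ne (b := true) (starts_of_Y (.inr hg)) hk

theorem not_X0_one : ¬ X0 1 := by
  rintro ⟨n, l, e, hn, he, h⟩
  revert h
  rw [eq_comm]
  change syl false n * (syl true l * e) ≠ 1
  rcases eq_or_ne l 0 with rfl | hl
  · rw [syl_zero, one_mul]
    rcases he with rfl | ⟨c, hc, rfl⟩ | ⟨c, hc, rfl⟩
    · exact Starts.syl_mul_ne (starts_one _) hn
    · rw [pre, syl_mul_assoc]
      by_cases h : n + 1 = 0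
      · rw [h, syl_zero, one_mul]
        exact Starts.syl_mul_ne (b := true)
          (starts_x (starts_y hc (by norm_num)) (by norm_num)) (by norm_num)
      · exact Starts.syl_mul_ne (b := false) (starts_pre_tail hc) h
    · rw [postInv, syl_mul_assoc]
      by_cases h : n + -100 = 0
      · rw [h, syl_zero, one_mul]
        exact Starts.syl_mul_ne (b := true) (starts_x hc (by norm_num)) (by norm_num)
      · exact Starts.syl_mul_ne (b := false) (starts_postInv_tail hc) h
  · exact Starts.syl_mul_ne (b := false) (starts_y (starts_of_Y he) hl) hn

theorem θ'_injective : Function.Injective θ' := by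
  rw [injective_iff_map_eq_one]
  intro m hm
  rcases θ'_mul (.inl rfl) m with ⟨k, rfl⟩ | ⟨k, g, hg, h⟩
  · rw [θ'_y] at hm
    by_contra hk
    exact syl_ne_one true (fun h => hk (by rw [h, syl_zero])) hm
  · rw [hm, one_mul] at h
    exact absurd h.symm (hg.syl_mul_ne_one k)

/-- The automorphism with `x ↦ x y`, `y ↦ y`. -/
def shear : ZZ →* ZZ := lift (syl false 1 * syl true 1) (syl true 1)

theorem shear_y (n : ℤ) : shear (syl true n) = syl true n := by
  rw [shear, lift_syl, cond_true, syl_zpow, mul_one]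

theorem shear_injective : Function.Injective shear := by
  have h : (lift (syl false 1 * syl true (-1)) (syl true 1)).comp shear = MonoidHom.id ZZ := by
    refine hom_ext fun b => ?_
    cases b <;> simp [shear, lift_syl, mul_assoc, syl_mul, syl_zero]
  exact Function.LeftInverse.injective (DFunLike.congr_fun h)

/-- The endomorphism with `x ↦ u(x, y)`, `y ↦ y`. -/
def θ : ZZ →* ZZ := lift (uElt (syl false 1) (syl true 1)) (syl true 1)

theorem θ_x : θ (syl false 1) = uElt (syl false 1) (syl true 1) := by
  rw [θ, lift_syl, cond_false, zpow_one]

theorem θ_y (n : ℤ) : θ (syl true n) = syl true n := by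
  rw [θ, lift_syl, cond_true, syl_zpow, mul_one]

theorem θ_eq : θ = θ'.comp shear := by
  refine hom_ext fun b => ?_
  cases b
  · rw [θ_x, MonoidHom.comp_apply, shear, lift_syl, cond_false, zpow_one, map_mul, θ'_x, θ'_y,
      zpow_one, q, mul_assoc, syl_mul, neg_add_cancel, syl_zero, mul_one]
  · rw [θ_y, MonoidHom.comp_apply, shear_y, θ'_y]

theorem θ_injective : Function.Injective θ := by
  rw [θ_eq]
  exact θ'_injective.comp shear_injective

/-- The iterates of `x` under `θ`. -/
def v : ℕ → ZZ
  | 0 => syl false 1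
  | k + 1 => θ (v k)

theorem uElt_v (k : ℕ) : uElt (v k) (syl true 1) = v (k + 1) := by
  induction k with
  | zero => exact θ_x.symm
  | succ k ih =>
    have := congrArg θ ih
    rwa [map_uElt, θ_y] at this

/-- The homomorphism from a free group sending the basis elements to iterates of `x`. -/
def V (N : ℕ) : FreeGroup (Fin N) →* ZZ := FreeGroup.lift fun k => v k

theorem V_succ {N : ℕ} (a : FreeGroup (Fin N)) :
    V (N + 1) (FreeGroup.map Fin.succ a) = θ (V N a) := by
  have : (V (N + 1)).comp (FreeGroup.map Fin.succ) = θ.comp (V N) := by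
    ext k
    simp [V, v]
  exact DFunLike.congr_fun this a

/-- Alternating products of powers of the first basis element and of elements of the subgroup
generated by the others; the flag tells which kind of factor may come first. -/
inductive Alt {N : ℕ} : Bool → FreeGroup (Fin (N + 1)) → Prop
  | one (b : Bool) : Alt b 1
  | zero {w : FreeGroup (Fin (N + 1))} (n : ℤ) :
    n ≠ 0 → Alt true w → Alt false (FreeGroup.of 0 ^ n * w)
  | succ {w : FreeGroup (Fin (N + 1))} (a : FreeGroup (Fin N)) :
    a ≠ 1 → Alt false w → Alt true (FreeGroup.map Fin.succ a * w)

theorem Alt.zpow_mul {N : ℕ} {b : Bool} {w : FreeGroup (Fin (N + 1))} (hw : Alt b w) (n : ℤ) :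
    ∃ b, Alt b (FreeGroup.of 0 ^ n * w) := by
  rcases eq_or_ne n 0 with rfl | hn
  · exact ⟨b, by simpa using hw⟩
  cases hw with
  | one => exact ⟨_, .zero n hn (.one _)⟩
  | zero m hm hw =>
    rw [← mul_assoc, ← zpow_add]
    by_cases h : n + m = 0
    · exact ⟨true, by simpa [h] using hw⟩
    · exact ⟨_, .zero _ h hw⟩
  | succ a ha hw => exact ⟨_, .zero n hn (.succ a ha hw)⟩

theorem Alt.map_succ_mul {N : ℕ} {b : Bool} {w : FreeGroup (Fin (N + 1))} (hw : Alt b w)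
    (a : FreeGroup (Fin N)) : ∃ b, Alt b (FreeGroup.map Fin.succ a * w) := by
  rcases eq_or_ne a 1 with rfl | ha
  · exact ⟨b, by simpa using hw⟩
  cases hw with
  | one => exact ⟨_, .succ a ha (.one _)⟩
  | zero m hm hw => exact ⟨_, .succ a ha (.zero m hm hw)⟩
  | succ c hc hw =>
    rw [← mul_assoc, ← map_mul]
    by_cases h : a * c = 1
    · exact ⟨false, by simpa [h] using hw⟩
    · exact ⟨_, .succ _ h hw⟩

theorem exists_alt {N : ℕ} (w : FreeGroup (Fin (N + 1))) : ∃ b, Alt b w := by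
  suffices ∀ w', (∃ b, Alt b w') → ∃ b, Alt b (w * w') by simpa using this 1 ⟨true, .one _⟩
  have hof (n : ℤ) (k : Fin (N + 1)) (w' : FreeGroup (Fin (N + 1))) (h : ∃ b, Alt b w') :
      ∃ b, Alt b (FreeGroup.of k ^ n * w') := by
    obtain ⟨b, hb⟩ := h
    induction k using Fin.cases with
    | zero => exact hb.zpow_mul n
    | succ k => simpa using hb.map_succ_mul (FreeGroup.of k ^ n)
  induction w using FreeGroup.induction_on with
  | C1 => simp
  | of k => simpa using hof 1 k
  | inv_of k _ => simpa using hof (-1) k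
  | mul x y hx hy => exact fun w' h => by simpa [mul_assoc] using hx _ (hy _ h)

theorem Alt.V_mul {N : ℕ} (hN : ∀ a k, V N a = syl true k → a = 1) {b : Bool}
    {w : FreeGroup (Fin (N + 1))} (hw : Alt b w) :
    (b = false → w = 1 ∨ ∀ m, X0 (V (N + 1) w * θ' m)) ∧
      (b = true → ∀ m, ∃ k e, (e = 1 ∨ Y e) ∧ V (N + 1) w * θ' m = syl true k * e) := by
  have hL (m : ZZ) : ∃ k e, (e = 1 ∨ Y e) ∧ θ' m = syl true k * e := by
    rcases θ'_mul (.inl rfl) m with ⟨k, rfl⟩ | ⟨k, g, hg, h⟩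
    · exact ⟨k, 1, .inl rfl, by rw [θ'_y, mul_one]⟩
    · exact ⟨k, g, .inr hg, by rw [← h, mul_one]⟩
  induction hw with
  | one => exact ⟨fun _ => .inl rfl, fun _ m => by simpa using hL m⟩
  | zero n hn hw ih =>
    refine ⟨fun _ => .inr fun m => ?_, by simp⟩
    obtain ⟨k, e, he, h⟩ := ih.2 rfl m
    refine ⟨n, k, e, hn, he, ?_⟩
    rw [map_mul, mul_assoc, h, map_zpow]
    congr 1
    rw [V, FreeGroup.lift_apply_of, Fin.val_zero, v, syl_zpow, mul_one]
  | succ a ha hw ih =>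
    refine ⟨by simp, fun _ m => ?_⟩
    rw [map_mul, V_succ, mul_assoc, θ_eq, MonoidHom.comp_apply]
    rcases ih.1 rfl with rfl | h
    · rw [map_one, one_mul, ← map_mul]
      exact hL _
    · rcases θ'_mul (.inr (h m)) (shear (V N a)) with ⟨k, hk⟩ | ⟨k, g, hg, h'⟩
      · rw [← shear_y] at hk
        exact absurd (hN a k (shear_injective hk)) ha
      · exact ⟨k, g, .inr hg, h'⟩

theorem mem_range_map_succ_of_V {N : ℕ} (hN : ∀ a k, V N a = syl true k → a = 1)
    {w : FreeGroup (Fin (N + 1))} {c : ZZ} (hw : V (N + 1) w = θ c) :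
    ∃ a, w = FreeGroup.map Fin.succ a := by
  have key {w : FreeGroup (Fin (N + 1))} (ha : Alt false w) {c : ZZ} (hw : V (N + 1) w = θ c) :
      w = 1 := by
    refine ((ha.V_mul hN).1 rfl).resolve_right fun h => not_X0_one ?_
    simpa [hw, θ_eq] using h (shear c)⁻¹
  obtain ⟨b, hb⟩ := exists_alt w
  cases hb with
  | one => exact ⟨1, by simp⟩
  | zero n hn h => exact ⟨1, by simpa using key (.zero n hn h) hw⟩
  | @succ w a ha h =>
    refine ⟨a, ?_⟩
    rw [key h (c := (V N a)⁻¹ * c), mul_one]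
    rw [map_mul, map_inv, ← hw, map_mul, V_succ, inv_mul_cancel_left]

theorem eq_one_of_V {N : ℕ} : ∀ a k, V N a = syl true k → a = 1 := by
  induction N with
  | zero => exact fun a k _ => Subsingleton.elim a 1
  | succ N ih =>
    intro w k hw
    obtain ⟨a, rfl⟩ := mem_range_map_succ_of_V ih (c := syl true k) (by rw [hw, θ_y])
    rw [ih a k (θ_injective (by rw [← V_succ, hw, θ_y])), map_one]

theorem exists_map_val (w : FreeGroup ℕ) :
    ∃ N, ∃ a : FreeGroup (Fin (N + 1)), FreeGroup.map Fin.val a = w := by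
  induction w using FreeGroup.induction_on with
  | C1 => exact ⟨0, 1, by simp⟩
  | of k => exact ⟨k, FreeGroup.of (Fin.last k), by simp⟩
  | inv_of k _ => exact ⟨k, (FreeGroup.of (Fin.last k))⁻¹, by simp⟩
  | mul x y hx hy =>
    obtain ⟨M, a, rfl⟩ := hx
    obtain ⟨N, b, rfl⟩ := hy
    refine ⟨M + N, FreeGroup.map (Fin.castLE (by omega)) a *
      FreeGroup.map (Fin.castLE (by omega)) b, ?_⟩
    simp only [map_mul, FreeGroup.map.comp, Function.comp_def, Fin.val_castLE]

theorem lift_v_map_val {N : ℕ} (a : FreeGroup (Fin N)) :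
    FreeGroup.lift v (FreeGroup.map Fin.val a) = V N a := by
  have : (FreeGroup.lift v).comp (FreeGroup.map Fin.val) = V N := by
    ext k
    simp [V]
  exact DFunLike.congr_fun this a

theorem lift_v_injective : Function.Injective (FreeGroup.lift v) := by
  rw [injective_iff_map_eq_one]
  intro w hw
  obtain ⟨N, a, rfl⟩ := exists_map_val w
  rw [lift_v_map_val] at hw
  rw [eq_one_of_V a 0 (by rw [hw, syl_zero]), map_one]

theorem mem_range_map_succ {w : FreeGroup ℕ} (hw : FreeGroup.lift v w ∈ θ.range) :
    w ∈ (FreeGroup.map Nat.succ).range := by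
  obtain ⟨N, a, rfl⟩ := exists_map_val w
  obtain ⟨c, hc⟩ := hw
  rw [lift_v_map_val] at hc
  obtain ⟨b, rfl⟩ := mem_range_map_succ_of_V eq_one_of_V hc.symm
  refine ⟨FreeGroup.map Fin.val b, ?_⟩
  rw [← MonoidHom.comp_apply, ← MonoidHom.comp_apply]
  congr 1
  ext k
  simp

end ZZ

/-! ### Maps between amalgamated free products -/

namespace Monoid.PushoutI

open CoprodI Function

variable {ι : Type*} {H H' : Type*} [Group H] [Group H'] {G G' : ι → Type*}
  [∀ i, Group (G i)] [∀ i, Group (G' i)] {φ : ∀ i, H →* G i} {φ' : ∀ i, H' →* G' i}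

theorem exists_base_mul_reduced (hφ : ∀ i, Injective (φ i)) (x : PushoutI φ) :
    ∃ h, ∃ w : CoprodI.Word G, Reduced φ w ∧ x = base φ h * ofCoprodI w.prod := by
  classical
  obtain ⟨d⟩ := NormalWord.transversal_nonempty φ hφ
  obtain ⟨w, rfl⟩ := (NormalWord.equiv (d := d)).symm.surjective x
  refine ⟨w.head, w.toWord, fun ⟨i, g⟩ hg hr => w.ne_one _ hg ?_, rfl⟩
  have := @(d.compl i).1 (⟨g, hr⟩, ⟨1, d.one_mem i⟩) (⟨1, one_mem _⟩, ⟨g, w.normalized i g hg⟩)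
    (by simp)
  exact congrArg Subtype.val (congrArg Prod.fst this)

theorem Reduced.eq_empty_of_mem_range_of (hφ : ∀ i, Injective (φ i)) {w : CoprodI.Word G}
    (hw : Reduced φ w) {i : ι} (hi : w.fstIdx ≠ some i)
    (h : (ofCoprodI w.prod : PushoutI φ) ∈ (of (φ := φ) i).range) : w = .empty := by
  obtain ⟨g, hg⟩ := h
  by_cases hr : g ∈ (φ i).range
  · obtain ⟨c, rfl⟩ := hr
    exact hw.eq_empty_of_mem_range hφ ⟨c, by rw [← hg, of_apply_eq_base]⟩
  · have h1 : g⁻¹ ≠ 1 := fun h => hr (by rw [inv_eq_one.mp h]; exact one_mem _)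
    have hred : Reduced φ (CoprodI.Word.cons g⁻¹ w hi h1) := by
      rintro ⟨j, l⟩ hl
      rcases List.mem_cons.mp hl with hl | hl
      · obtain ⟨rfl, hl⟩ := Sigma.mk.inj hl
        rw [eq_of_heq hl]
        simpa using hr
      · exact hw _ hl
    have := hred.eq_empty_of_mem_range hφ ⟨1, by
      rw [CoprodI.Word.prod_cons, map_mul, ofCoprodI_of, ← hg, map_one, map_inv, inv_mul_cancel]⟩
    simpa [CoprodI.Word.cons, CoprodI.Word.empty] using congrArg CoprodI.Word.toList this

variable {f : ∀ i, G i →* G' i}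

theorem Reduced.exists_map (hfφ : ∀ i g, f i g ∈ (φ' i).range → g ∈ (φ i).range)
    {w : CoprodI.Word G} (hw : Reduced φ w) :
    ∃ w' : CoprodI.Word G', Reduced φ' w' ∧ w'.fstIdx = w.fstIdx ∧
      (w' = .empty → w = .empty) ∧ w'.prod =
        CoprodI.lift (fun i => CoprodI.of.comp (f i)) w.prod := by
  induction w using CoprodI.Word.consRecOn with
  | empty => exact ⟨.empty, by simp [Reduced, CoprodI.Word.empty], rfl, by simp, by simp⟩
  | cons i g w h1 h2 ih =>
    obtain ⟨w', hw', hi, -, hp⟩ := ih fun _ hg => hw _ (List.mem_cons_of_mem _ hg)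
    have hg : f i g ∉ (φ' i).range := fun h => hw _ List.mem_cons_self (hfφ i g h)
    have h2' : f i g ≠ 1 := fun h => hg (by rw [h]; exact one_mem _)
    refine ⟨.cons (f i g) w' (by rwa [hi]) h2', ?_, by simp [CoprodI.Word.fstIdx_cons], ?_, ?_⟩
    · rintro ⟨j, l⟩ hl
      rcases List.mem_cons.mp hl with hl | hl
      · obtain ⟨rfl, hl⟩ := Sigma.mk.inj hl
        rwa [eq_of_heq hl]
      · exact hw' _ hl
    · intro h
      simpa [CoprodI.Word.cons, CoprodI.Word.empty] using congrArg CoprodI.Word.toList h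
    · rw [CoprodI.Word.prod_cons, CoprodI.Word.prod_cons, map_mul, hp, CoprodI.lift_of]
      rfl

variable {k : H →* H'}

/-- The homomorphism between amalgamated free products induced by a map of diagrams. -/
def map (f : ∀ i, G i →* G' i) (k : H →* H') (hfk : ∀ i, (f i).comp (φ i) = (φ' i).comp k) :
    PushoutI φ →* PushoutI φ' :=
  lift (fun i => (of i).comp (f i)) ((base φ').comp k) fun i => by
    rw [MonoidHom.comp_assoc, hfk, ← MonoidHom.comp_assoc, of_comp_eq_base]

theorem map_of (hfk : ∀ i, (f i).comp (φ i) = (φ' i).comp k) (i : ι) (g : G i) :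
    map f k hfk (of i g) = of i (f i g) := by
  rw [map, lift_of, MonoidHom.comp_apply]

theorem map_ofCoprodI (hfk : ∀ i, (f i).comp (φ i) = (φ' i).comp k) (x : CoprodI G) :
    map f k hfk (ofCoprodI x) = ofCoprodI (CoprodI.lift (fun i => CoprodI.of.comp (f i)) x) := by
  rw [← MonoidHom.comp_apply, ← MonoidHom.comp_apply]
  congr 1
  ext i g
  simp [map_of]

theorem map_injective (hφ : ∀ i, Injective (φ i)) (hφ' : ∀ i, Injective (φ' i))
    (hk : Injective k) (hfk : ∀ i, (f i).comp (φ i) = (φ' i).comp k)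
    (hfφ : ∀ i g, f i g ∈ (φ' i).range → g ∈ (φ i).range) : Injective (map f k hfk) := by
  rw [injective_iff_map_eq_one]
  intro x hx
  obtain ⟨h, w, hw, rfl⟩ := exists_base_mul_reduced hφ x
  obtain ⟨w', hw', -, he, hp⟩ := hw.exists_map hfφ
  have hb : map f k hfk (base φ h) = base φ' (k h) := by rw [map, lift_base, MonoidHom.comp_apply]
  rw [map_mul, map_ofCoprodI, hb, ← hp] at hx
  have := hw'.eq_empty_of_mem_range hφ'
    ⟨(k h)⁻¹, by rw [map_inv, eq_comm, ← mul_eq_one_iff_inv_eq.mp hx]⟩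
  obtain rfl := he this
  rw [this, CoprodI.Word.prod_empty, map_one, mul_one] at hx
  rw [hk (base_injective hφ' (hx.trans (by simp)) : k h = k 1)]
  simp

theorem mem_range_of_map_mem_range (hφ : ∀ i, Injective (φ i)) (hφ' : ∀ i, Injective (φ' i))
    (hfk : ∀ i, (f i).comp (φ i) = (φ' i).comp k)
    (hfφ : ∀ i g, f i g ∈ (φ' i).range → g ∈ (φ i).range) {i : ι} {x : PushoutI φ}
    (hx : map f k hfk x ∈ (of (φ := φ') i).range) : x ∈ (of (φ := φ) i).range := by
  obtain ⟨h, w, hw, rfl⟩ := exists_base_mul_reduced hφ x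
  have hb : map f k hfk (base φ h) ∈ (of (φ := φ') i).range := by
    rw [← of_apply_eq_base φ i, map_of]
    exact ⟨_, rfl⟩
  rw [map_mul, Subgroup.mul_mem_cancel_left _ hb] at hx
  refine mul_mem ⟨φ i h, of_apply_eq_base φ i h⟩ ?_
  clear hb
  have key {w : CoprodI.Word G} (hw : Reduced φ w) (hi : w.fstIdx ≠ some i)
      (hx : map f k hfk (ofCoprodI w.prod) ∈ (of (φ := φ') i).range) : w = .empty := by
    obtain ⟨w', hw', hi', he, hp⟩ := hw.exists_map hfφ
    rw [map_ofCoprodI, ← hp] at hx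
    exact he (hw'.eq_empty_of_mem_range_of hφ' (hi' ▸ hi) hx)
  by_cases hi : w.fstIdx = some i
  · induction w using CoprodI.Word.consRecOn with
    | empty => simp [CoprodI.Word.fstIdx, CoprodI.Word.empty] at hi
    | cons j g w h1 h2 _ =>
      obtain rfl : j = i := by simpa [CoprodI.Word.fstIdx_cons] using hi
      rw [CoprodI.Word.prod_cons, map_mul, map_mul, ofCoprodI_of, map_of,
        Subgroup.mul_mem_cancel_left _ (MonoidHom.mem_range.mpr ⟨_, rfl⟩)] at hx
      rw [CoprodI.Word.prod_cons, key (fun _ hg => hw _ (List.mem_cons_of_mem _ hg)) h1 hx]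
      exact ⟨g, by simp⟩
  · rw [key hw hi hx]
    exact ⟨1, by simp⟩

end Monoid.PushoutI

/-! ### Amalgamated free products of two groups -/

/-- The family of two types indexed by `Bool`. -/
def BoolPair (A B : Type) : Bool → Type
  | false => A
  | true => B

instance BoolPair.group {A B : Type} [Group A] [Group B] : ∀ b, Group (BoolPair A B b)
  | false => inferInstanceAs (Group A)
  | true => inferInstanceAs (Group B)

/-- Two homomorphisms as a family indexed by `Bool`. -/
def BoolPair.hom {C A B : Type} [Group C] [Group A] [Group B] (α : C →* A) (β : C →* B) :
    ∀ b, C →* BoolPair A B b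
  | false => α
  | true => β

theorem BoolPair.hom_injective {C A B : Type} [Group C] [Group A] [Group B] {α : C →* A}
    {β : C →* B} (hα : Function.Injective α) (hβ : Function.Injective β) :
    ∀ b, Function.Injective (BoolPair.hom α β b)
  | false => hα
  | true => hβ

/-- Two homomorphisms with the same target as a homomorphism on each member of the family. -/
def BoolPair.elim {A B K : Type} [Group A] [Group B] [Group K] (f : A →* K) (g : B →* K) :
    ∀ b, BoolPair A B b →* K
  | false => f
  | true => g

theorem BoolPair.elim_comp {C A B K : Type} [Group C] [Group A] [Group B] [Group K] {α : C →* A}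
    {β : C →* B} {f : A →* K} {g : B →* K} (h : f.comp α = g.comp β) :
    ∀ b, (BoolPair.elim f g b).comp (BoolPair.hom α β b) = f.comp α
  | false => rfl
  | true => h.symm

/-- The amalgamated free product of two groups. -/
abbrev Amalgam {C A B : Type} [Group C] [Group A] [Group B] (α : C →* A) (β : C →* B) : Type :=
  Monoid.PushoutI (BoolPair.hom α β)

namespace Amalgam

open Monoid Function

variable {C A B C' A' B' K : Type} [Group C] [Group A] [Group B] [Group C'] [Group A'] [Group B']
  [Group K] {α : C →* A} {β : C →* B} {α' : C' →* A'} {β' : C' →* B'}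

/-- The homomorphism from the first factor. -/
def inl : A →* Amalgam α β := PushoutI.of (φ := BoolPair.hom α β) false

/-- The homomorphism from the second factor. -/
def inr : B →* Amalgam α β := PushoutI.of (φ := BoolPair.hom α β) true

theorem inl_apply (c : C) : (inl (α c) : Amalgam α β) = inr (β c) :=
  (PushoutI.of_apply_eq_base (BoolPair.hom α β) false c).trans
    (PushoutI.of_apply_eq_base (BoolPair.hom α β) true c).symm

theorem inl_injective (hα : Injective α) (hβ : Injective β) :
    Injective (inl : A →* Amalgam α β) :=
  PushoutI.of_injective (BoolPair.hom_injective hα hβ) false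

theorem inr_injective (hα : Injective α) (hβ : Injective β) :
    Injective (inr : B →* Amalgam α β) :=
  PushoutI.of_injective (BoolPair.hom_injective hα hβ) true

/-- The universal property of the amalgamated free product. -/
def lift (f : A →* K) (g : B →* K) (h : f.comp α = g.comp β) : Amalgam α β →* K :=
  PushoutI.lift (BoolPair.elim f g) (f.comp α) (BoolPair.elim_comp h)

theorem lift_inl (f : A →* K) (g : B →* K) (h : f.comp α = g.comp β) (a : A) :
    lift f g h (inl a) = f a :=
  PushoutI.lift_of (BoolPair.elim f g) (f.comp α) (BoolPair.elim_comp h) (i := false) a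

theorem lift_inr (f : A →* K) (g : B →* K) (h : f.comp α = g.comp β) (b : B) :
    lift f g h (inr b) = g b :=
  PushoutI.lift_of (BoolPair.elim f g) (f.comp α) (BoolPair.elim_comp h) (i := true) b

theorem exists_map (hα : Injective α) (hβ : Injective β) (hα' : Injective α')
    (hβ' : Injective β') {f : A →* A'} {g : B →* B'} {k : C →* C'} (hk : Injective k)
    (hf : f.comp α = α'.comp k) (hg : g.comp β = β'.comp k)
    (hfα : ∀ a, f a ∈ α'.range → a ∈ α.range) (hgβ : ∀ b, g b ∈ β'.range → b ∈ β.range) :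
    ∃ F : Amalgam α β →* Amalgam α' β', (∀ a, F (inl a) = inl (f a)) ∧
      (∀ b, F (inr b) = inr (g b)) ∧ Injective F ∧
      (∀ x, F x ∈ (inl : A' →* Amalgam α' β').range → x ∈ (inl : A →* Amalgam α β).range) ∧
      (∀ x, F x ∈ (inr : B' →* Amalgam α' β').range → x ∈ (inr : B →* Amalgam α β).range) := by
  let e (b : Bool) : BoolPair A B b →* BoolPair A' B' b :=
    match b with
    | false => f
    | true => g
  have he : ∀ b, (e b).comp (BoolPair.hom α β b) = (BoolPair.hom α' β' b).comp k
    | false => hf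
    | true => hg
  have hr : ∀ b a, e b a ∈ (BoolPair.hom α' β' b).range → a ∈ (BoolPair.hom α β b).range
    | false => hfα
    | true => hgβ
  have h := BoolPair.hom_injective hα hβ
  have h' := BoolPair.hom_injective hα' hβ'
  exact ⟨PushoutI.map e k he, PushoutI.map_of he false, PushoutI.map_of he true,
    PushoutI.map_injective h h' hk he hr,
    fun _ => PushoutI.mem_range_of_map_mem_range h h' he hr,
    fun _ => PushoutI.mem_range_of_map_mem_range h h' he hr⟩

end Amalgam

/-! ### Systems of elements with prescribed values of `u(-, y)` -/

/-- The self-map `φ` of `S` is realized by the map `s ↦ u(s, y)` on a free basis of a free subgroup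
of some group containing `y`, in such a way that every element of the basis generates a free group
of rank two together with `y`, which meets the free subgroup in the obvious way. -/
def Realizable (S : Type) (φ : S → S) : Prop :=
  ∃ (Q : Type) (_ : Group Q) (y : Q) (ξ : S → Q), (∀ s, uElt (ξ s) y = ξ (φ s)) ∧
    Function.Injective (FreeGroup.lift ξ) ∧ (∀ s, Function.Injective (ZZ.lift (ξ s) y)) ∧
    ∀ s w, FreeGroup.lift ξ w ∈ (ZZ.lift (ξ s) y).range →
      w ∈ (FreeGroup.map fun k => φ^[k] s).range

theorem ZZ.lift_comp {A B : Type*} [Group A] [Group B] (f : A →* B) (x y : A) :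
    f.comp (ZZ.lift x y) = ZZ.lift (f x) (f y) := by
  refine ZZ.hom_ext fun b => ?_
  cases b <;> simp [ZZ.lift_syl]

theorem ZZ.lift_self : ZZ.lift (ZZ.syl false 1) (ZZ.syl true 1) = MonoidHom.id ZZ := by
  refine ZZ.hom_ext fun b => ?_
  cases b <;> simp [ZZ.lift_syl]

theorem ZZ.lift_v_succ (s : ℕ) : ZZ.lift (ZZ.v (s + 1)) (ZZ.syl true 1) =
    ZZ.θ.comp (ZZ.lift (ZZ.v s) (ZZ.syl true 1)) := by
  rw [ZZ.lift_comp, ZZ.θ_y, ZZ.v]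

theorem realizable_succ : Realizable ℕ Nat.succ := by
  refine ⟨ZZ, inferInstance, ZZ.syl true 1, ZZ.v, ZZ.uElt_v, ZZ.lift_v_injective, fun s => ?_,
    fun s => ?_⟩
  · induction s with
    | zero =>
      rw [ZZ.v, ZZ.lift_self]
      exact Function.injective_id
    | succ s ih =>
      rw [ZZ.lift_v_succ]
      exact ZZ.θ_injective.comp ih
  · induction s with
    | zero =>
      intro w _
      exact ⟨w, by simp [Nat.succ_iterate]⟩
    | succ s ih =>
      rintro w ⟨c, hc⟩
      rw [ZZ.lift_v_succ] at hc
      obtain ⟨w, rfl⟩ := ZZ.mem_range_map_succ ⟨_, hc⟩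
      have h : (FreeGroup.lift ZZ.v).comp (FreeGroup.map Nat.succ) =
          ZZ.θ.comp (FreeGroup.lift ZZ.v) := by
        ext k
        simp [ZZ.v]
      rw [MonoidHom.comp_apply, show FreeGroup.lift ZZ.v (FreeGroup.map Nat.succ w) = _ from
        DFunLike.congr_fun h w] at hc
      obtain ⟨a, rfl⟩ := ih w ⟨c, ZZ.θ_injective hc⟩
      refine ⟨a, ?_⟩
      rw [FreeGroup.map.comp]
      congr 2
      funext k
      simp only [Function.comp_apply, Nat.succ_iterate]
      omega

/-- The extension of a self-map of `S` to `Option S` which sends the new element to `p`. -/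
def extendMap {S : Type} (φ : S → S) (p : S) : Option S → Option S
  | none => some p
  | some s => some (φ s)

theorem extendMap_iterate_some {S : Type} (φ : S → S) (p s : S) (k : ℕ) :
    (extendMap φ p)^[k] (some s) = some (φ^[k] s) := by
  induction k with
  | zero => rfl
  | succ k ih => rw [Function.iterate_succ_apply', Function.iterate_succ_apply', ih, extendMap]

theorem ZZ.lift_apply_v {S Q : Type} [Group Q] {φ : S → S} {ξ : S → Q} {y : Q}
    (h : ∀ s, uElt (ξ s) y = ξ (φ s)) (p : S) (k : ℕ) :
    ZZ.lift (ξ p) y (ZZ.v k) = ξ (φ^[k] p) := by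
  induction k with
  | zero => simp [ZZ.v, ZZ.lift_syl]
  | succ k ih =>
    rw [← ZZ.uElt_v, map_uElt, ih, ZZ.lift_syl, cond_true, zpow_one, h,
      Function.iterate_succ_apply']

theorem Realizable.extend {S : Type} {φ : S → S} (hS : Realizable S φ) (p : S) :
    Realizable (Option S) (extendMap φ p) := by
  obtain ⟨Q, _, y, ξ, h1, h2, h3, h4⟩ := hS
  let α : FreeGroup ℕ →* FreeGroup S := FreeGroup.map fun k => φ^[k] p
  let β : FreeGroup ℕ →* FreeGroup ℕ := FreeGroup.map Nat.succ
  let ψ : ZZ →* Q := ZZ.lift (ξ p) y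
  have hαψ : (FreeGroup.lift ξ).comp α = ψ.comp (FreeGroup.lift ZZ.v) := by
    ext k
    simp [α, ψ, ZZ.lift_apply_v h1]
  have hβθ : (FreeGroup.lift ZZ.v).comp β = ZZ.θ.comp (FreeGroup.lift ZZ.v) := by
    ext k
    simp [β, ZZ.v]
  have hα : Function.Injective α := by
    refine Function.Injective.of_comp (f := FreeGroup.lift ξ) ?_
    rw [← MonoidHom.coe_comp, hαψ]
    exact (h3 p).comp ZZ.lift_v_injective
  have hβ : Function.Injective β := by
    refine Function.Injective.of_comp (f := FreeGroup.lift ZZ.v) ?_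
    rw [← MonoidHom.coe_comp, hβθ]
    exact ZZ.θ_injective.comp ZZ.lift_v_injective
  obtain ⟨F, hFl, hFr, hF, hFl', hFr'⟩ := Amalgam.exists_map hα hβ (h3 p) ZZ.θ_injective
    ZZ.lift_v_injective hαψ hβθ (h4 p) fun _ => ZZ.mem_range_map_succ
  let δ : ℕ → Option S := fun k => (extendMap φ p)^[k] none
  have hδ (k : ℕ) : δ (k + 1) = some (φ^[k] p) := by
    simp only [δ, Function.iterate_succ_apply, extendMap, extendMap_iterate_some]
  let r : Amalgam α β →* FreeGroup (Option S) :=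
    Amalgam.lift (FreeGroup.map some) (FreeGroup.map δ) (by
      ext k
      simp [α, β, hδ])
  let j : FreeGroup (Option S) →* Amalgam α β :=
    FreeGroup.lift fun | none => Amalgam.inr (FreeGroup.of 0) | some s => Amalgam.inl (.of s)
  have hrj (w : FreeGroup (Option S)) : r (j w) = w := by
    have : r.comp j = MonoidHom.id _ := by
      ext s
      cases s <;> simp [r, j, Amalgam.lift_inl, Amalgam.lift_inr, δ]
    exact DFunLike.congr_fun this w
  let y' : Amalgam ψ ZZ.θ := Amalgam.inl y
  have hy' : y' = Amalgam.inr (ZZ.syl true 1) := by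
    rw [← ZZ.θ_y, ← Amalgam.inl_apply, ZZ.lift_syl, cond_true, zpow_one]
  let ξ' : Option S → Amalgam ψ ZZ.θ
    | none => Amalgam.inr (ZZ.syl false 1)
    | some s => Amalgam.inl (ξ s)
  have hξ' (w : FreeGroup (Option S)) : FreeGroup.lift ξ' w = F (j w) := by
    have : FreeGroup.lift ξ' = F.comp j := by
      ext s
      cases s <;> simp [ξ', j, hFl, hFr, ZZ.v]
    exact DFunLike.congr_fun this w
  have hnone : ZZ.lift (ξ' none) y' = Amalgam.inr := by
    rw [hy']
    simp only [ξ']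
    rw [← ZZ.lift_comp, ZZ.lift_self, MonoidHom.comp_id]
  have hsome (s : S) : ZZ.lift (ξ' (some s)) y' = Amalgam.inl.comp (ZZ.lift (ξ s) y) := by
    rw [ZZ.lift_comp]
  refine ⟨Amalgam ψ ZZ.θ, inferInstance, y', ξ', ?_, ?_, ?_, ?_⟩
  · rintro (_ | s)
    · rw [hy']
      simp only [ξ', extendMap]
      rw [← map_uElt, ← ZZ.θ_x, ← Amalgam.inl_apply, ZZ.lift_syl, cond_false, zpow_one]
    · simp only [ξ', extendMap, y']
      rw [← map_uElt, h1]
  · rw [show ⇑(FreeGroup.lift ξ') = F ∘ j from funext hξ']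
    exact hF.comp (Function.LeftInverse.injective hrj)
  · rintro (_ | s)
    · rw [hnone]
      exact Amalgam.inr_injective (h3 p) ZZ.θ_injective
    · rw [hsome]
      exact (Amalgam.inl_injective (h3 p) ZZ.θ_injective).comp (h3 s)
  · rintro (_ | s) w hw
    · rw [hnone, hξ'] at hw
      obtain ⟨c, hc⟩ := hFr' _ hw
      refine ⟨c, ?_⟩
      rw [← hrj w, ← hc]
      exact (Amalgam.lift_inr _ _ _ c).symm
    · obtain ⟨c, hc⟩ := hw
      rw [hsome, hξ', MonoidHom.comp_apply] at hc
      obtain ⟨w', hw'⟩ := hFl' _ ⟨_, hc⟩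
      rw [← hw', hFl] at hc
      obtain ⟨a, rfl⟩ := h4 s w' ⟨c, Amalgam.inl_injective (h3 p) ZZ.θ_injective hc⟩
      refine ⟨a, ?_⟩
      rw [← hrj w, ← hw']
      refine Eq.trans ?_ (Amalgam.lift_inl _ _ _ _).symm
      rw [FreeGroup.map.comp]
      congr 2
      funext k
      exact extendMap_iterate_some φ p s k

theorem exists_realizable {X : Type} {φ : X → Option X} (rank : X → ℤ)
    (hrank : ∀ x x', φ x = some x' → rank x < rank x') (S : Finset X) :
    ∃ (S' : Type) (φ' : S' → S') (e : X → S'), Realizable S' φ' ∧ Set.InjOn e S ∧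
      ∀ x ∈ S, ∀ x' ∈ S, φ x = some x' → e x' = φ' (e x) := by
  classical
  induction S using Finset.induction_on_min_value rank with
  | empty => exact ⟨ℕ, Nat.succ, fun _ => 0, realizable_succ, by simp, by simp⟩
  | insert a S ha hmin ih =>
    obtain ⟨S', φ', e, hS', he, hφ⟩ := ih
    refine ⟨_, _, fun x => if x = a then none else some (e x),
      hS'.extend (e ((φ a).getD a)), ?_, ?_⟩
    · intro x hx x' hx' h
      by_cases h1 : x = a <;> by_cases h2 : x' = a <;> simp_all
      exact he hx hx' h
    · intro x hx x' hx' h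
      have hlt := hrank x x' h
      have hx'a : x' ≠ a := by
        rintro rfl
        rcases Finset.mem_insert.mp hx with rfl | hx
        · exact lt_irrefl _ hlt
        · exact absurd (hmin x hx) (not_le.mpr hlt)
      have hx'S := (Finset.mem_insert.mp hx').resolve_left hx'a
      rcases Finset.mem_insert.mp hx with rfl | hxS
      · simp [hx'a, h, extendMap]
      · have hxa : x ≠ a := by
          rintro rfl
          exact ha hxS
        simp [hx'a, hxa, extendMap, hφ x hxS x' hx'S h]

/-! ### Groups presented by relations `u(x, y) = x'` -/

/-- The relators `u(x, y) x'⁻¹` for `φ y x = some x'`. -/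
def gammaRels {X Y : Type} (φ : Y → X → Option X) : Set (FreeGroup (X ⊕ Y)) :=
  {r | ∃ y x x', φ y x = some x' ∧ r = uElt (.of (.inl x)) (.of (.inr y)) * (.of (.inl x'))⁻¹}

/-- The group generated by `X` and `Y` subject to the relations `u(x, y) = x'` for
`φ y x = some x'`. -/
abbrev Gamma {X Y : Type} (φ : Y → X → Option X) : Type := PresentedGroup (gammaRels φ)

namespace Gamma

variable {X Y X' Y' A : Type} [Group A] {φ : Y → X → Option X} {φ' : Y' → X' → Option X'}

/-- The generators from `X`. -/
def x (a : X) : Gamma φ := PresentedGroup.of (.inl a)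

/-- The generators from `Y`. -/
def y (b : Y) : Gamma φ := PresentedGroup.of (.inr b)

theorem uElt_x_y {b : Y} {a a' : X} (h : φ b a = some a') :
    uElt (x a) (y b) = (x a' : Gamma φ) := by
  have hr : uElt (.of (.inl a)) (.of (.inr b)) * (.of (.inl a'))⁻¹ ∈ gammaRels φ :=
    ⟨b, a, a', h, rfl⟩
  have := PresentedGroup.one_of_mem hr
  rwa [map_mul, map_inv, mul_inv_eq_one, map_uElt] at this

/-- The universal property of `Gamma φ`. -/
def lift (ξ : X → A) (η : Y → A)
    (h : ∀ b a a', φ b a = some a' → uElt (ξ a) (η b) = ξ a') : Gamma φ →* A :=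
  PresentedGroup.toGroup (f := Sum.elim ξ η) (by
    rintro _ ⟨b, a, a', hφ, hr⟩
    rw [hr]
    simp [map_uElt, h b a a' hφ])

theorem lift_x (ξ : X → A) (η : Y → A) (h : ∀ b a a', φ b a = some a' → uElt (ξ a) (η b) = ξ a')
    (a : X) : lift ξ η h (x a) = ξ a :=
  PresentedGroup.toGroup.of _

theorem lift_y (ξ : X → A) (η : Y → A) (h : ∀ b a a', φ b a = some a' → uElt (ξ a) (η b) = ξ a')
    (b : Y) : lift ξ η h (y b) = η b :=
  PresentedGroup.toGroup.of _

theorem hom_ext {f g : Gamma φ →* A} (hx : ∀ a, f (x a) = g (x a))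
    (hy : ∀ b, f (y b) = g (y b)) : f = g :=
  PresentedGroup.ext fun | .inl a => hx a | .inr b => hy b

/-- The homomorphism induced by compatible maps of the generators. -/
def map (e : X → X') (f : Y → Y')
    (h : ∀ b a a', φ b a = some a' → φ' (f b) (e a) = some (e a')) : Gamma φ →* Gamma φ' :=
  lift (fun a => x (e a)) (fun b => y (f b)) fun b a a' ha => uElt_x_y (h b a a' ha)

theorem map_x (e : X → X') (f : Y → Y')
    (h : ∀ b a a', φ b a = some a' → φ' (f b) (e a) = some (e a')) (a : X) :
    map e f h (x a) = x (e a) :=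
  lift_x _ _ _ a

theorem map_y (e : X → X') (f : Y → Y')
    (h : ∀ b a a', φ b a = some a' → φ' (f b) (e a) = some (e a')) (b : Y) :
    map e f h (y b) = y (f b) :=
  lift_y _ _ _ b

variable (φ) in
/-- The homomorphism from the free group on `X`. -/
def free : FreeGroup X →* Gamma φ := FreeGroup.lift x

variable (φ) in
theorem free_of (a : X) : free φ (.of a) = x a := FreeGroup.lift_apply_of

theorem exists_finset_of_mem_normalClosure {g : FreeGroup (X ⊕ Y)}
    (hg : g ∈ Subgroup.normalClosure (gammaRels φ)) :
    ∃ E : Finset X, g ∈ Subgroup.normalClosure {r | ∃ b, ∃ a ∈ E, ∃ a' ∈ E, φ b a = some a' ∧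
      r = uElt (.of (.inl a)) (.of (.inr b)) * (.of (.inl a'))⁻¹} := by
  classical
  have hmono {E E' : Finset X} (h : E ⊆ E') : Subgroup.normalClosure {r | ∃ b, ∃ a ∈ E, ∃ a' ∈ E,
      φ b a = some a' ∧ r = uElt (FreeGroup.of (Sum.inl a)) (.of (.inr b)) * (.of (.inl a'))⁻¹} ≤
      Subgroup.normalClosure {r | ∃ b, ∃ a ∈ E', ∃ a' ∈ E',
      φ b a = some a' ∧
        r = uElt (FreeGroup.of (Sum.inl a)) (.of (.inr b)) * (.of (.inl a'))⁻¹} := by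
    refine Subgroup.normalClosure_mono ?_
    rintro r ⟨b, a, ha, a', ha', hr⟩
    exact ⟨b, a, h ha, a', h ha', hr⟩
  induction hg using Subgroup.closure_induction with
  | mem g hg =>
    obtain ⟨r, ⟨b, a, a', h, hr⟩, hc⟩ := Group.mem_conjugatesOfSet_iff.mp hg
    refine ⟨{a, a'}, Subgroup.conjugatesOfSet_subset_normalClosure
      (Group.mem_conjugatesOfSet_iff.mpr ⟨r, ⟨b, a, by simp, a', by simp, h, hr⟩, hc⟩)⟩
  | one => exact ⟨∅, one_mem _⟩
  | mul g g' _ _ ih ih' =>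
    obtain ⟨E, hE⟩ := ih
    obtain ⟨E', hE'⟩ := ih'
    exact ⟨E ∪ E', mul_mem (hmono Finset.subset_union_left hE)
      (hmono Finset.subset_union_right hE')⟩
  | inv g _ ih =>
    obtain ⟨E, hE⟩ := ih
    exact ⟨E, inv_mem hE⟩

theorem _root_.FreeGroup.eq_one_of_map_eq_one {α β : Type} [DecidableEq α] {e : α → β}
    {w : FreeGroup α} {S : Finset α} (hS : (w.toWord.map Prod.fst).toFinset ⊆ S)
    (he : Set.InjOn e S) (hw : FreeGroup.map e w = 1) : w = 1 := by
  cases isEmpty_or_nonempty α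
  · exact Subsingleton.elim _ _
  have h : FreeGroup.map (Function.invFunOn e S) (FreeGroup.map e w) = w := by
    conv_rhs => rw [← FreeGroup.mk_toWord (x := w)]
    conv_lhs => rw [← FreeGroup.mk_toWord (x := w)]
    rw [FreeGroup.map.mk, FreeGroup.map.mk, List.map_map]
    congr 1
    conv_rhs => rw [← List.map_id w.toWord]
    refine List.map_congr_left fun p hp => Prod.ext ?_ rfl
    exact he.leftInvOn_invFunOn (hS (List.mem_toFinset.mpr (List.mem_map_of_mem hp)))
  rw [← h, hw, map_one]

theorem free_injective_of_unique [Unique Y] (rank : X → ℤ)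
    (hrank : ∀ a a', φ default a = some a' → rank a < rank a') : Function.Injective (free φ) := by
  classical
  rw [injective_iff_map_eq_one]
  intro w hw
  have hw' : FreeGroup.map Sum.inl w ∈ Subgroup.normalClosure (gammaRels φ) := by
    rw [← PresentedGroup.mk_eq_one_iff, ← hw]
    have : (PresentedGroup.mk (gammaRels φ)).comp (FreeGroup.map Sum.inl) = free φ := by
      ext a
      rw [free_of]
      rfl
    exact DFunLike.congr_fun this w
  obtain ⟨E, hE⟩ := exists_finset_of_mem_normalClosure hw'
  obtain ⟨S', φ', e, ⟨Q, _, y, ξ, h1, h2, -, -⟩, he, hφ⟩ :=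
    exists_realizable rank hrank (E ∪ (w.toWord.map Prod.fst).toFinset)
  refine FreeGroup.eq_one_of_map_eq_one Finset.subset_union_right he (h2 ?_)
  have hker : Subgroup.normalClosure {r | ∃ b, ∃ a ∈ E, ∃ a' ∈ E, φ b a = some a' ∧
      r = uElt (FreeGroup.of (Sum.inl a)) (.of (.inr b)) * (.of (.inl a'))⁻¹} ≤
      (FreeGroup.lift (Sum.elim (fun a => ξ (e a)) fun _ => y)).ker := by
    refine Subgroup.normalClosure_le_normal ?_
    rintro r ⟨b, a, ha, a', ha', h, hr⟩
    rw [Subsingleton.elim b default] at h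
    have := hφ a (Finset.mem_union_left _ ha) a' (Finset.mem_union_left _ ha') h
    simp [hr, map_uElt, h1, this]
  have := hker hE
  rw [MonoidHom.mem_ker] at this
  rw [map_one, ← this, ← MonoidHom.comp_apply, ← MonoidHom.comp_apply]
  congr 1
  ext a
  simp

/-- The sets `J i` of generators from `Y` yield an amalgamated free product over the free group
on `X`, to which `Gamma φ` maps if the `J i` cover `Y`. -/
def toPushout {ι : Type} (J : ι → Set Y) (c : Y → ι) (hc : ∀ b, b ∈ J (c b)) :
    Gamma φ →* Monoid.PushoutI fun i => free fun b : J i => φ b :=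
  lift (fun a => Monoid.PushoutI.base _ (.of a))
    (fun b => Monoid.PushoutI.of (c b) (y ⟨b, hc b⟩)) fun b a a' h => by
      rw [← Monoid.PushoutI.of_apply_eq_base _ (c b), ← Monoid.PushoutI.of_apply_eq_base _ (c b),
        ← map_uElt, free_of, free_of]
      exact congrArg _ (uElt_x_y (φ := fun b' : J (c b) => φ b') (b := ⟨b, hc b⟩) h)

theorem toPushout_x {ι : Type} (J : ι → Set Y) (c : Y → ι) (hc : ∀ b, b ∈ J (c b)) (a : X) :
    toPushout (φ := φ) J c hc (x a) = Monoid.PushoutI.base _ (.of a) :=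
  lift_x _ _ _ a

theorem toPushout_y {ι : Type} (J : ι → Set Y) (c : Y → ι) (hc : ∀ b, b ∈ J (c b)) (b : Y) :
    toPushout (φ := φ) J c hc (y b) = Monoid.PushoutI.of (c b) (y ⟨b, hc b⟩) :=
  lift_y _ _ _ b

theorem free_injective (rank : Y → X → ℤ)
    (hrank : ∀ b a a', φ b a = some a' → rank b a < rank b a') : Function.Injective (free φ) := by
  have h (b : Y) : Function.Injective (free fun b' : ({b} : Set Y) => φ b') :=
    free_injective_of_unique (rank b) (hrank b)
  refine Function.Injective.of_comp (f := toPushout (fun b => {b}) id Set.mem_singleton) ?_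
  rw [← MonoidHom.coe_comp]
  convert Monoid.PushoutI.base_injective h
  ext a
  rw [MonoidHom.comp_apply, free_of, toPushout_x]

theorem map_subtype_injective (rank : Y → X → ℤ)
    (hrank : ∀ b a a', φ b a = some a' → rank b a < rank b a') (J : Set Y) :
    Function.Injective (map (φ := fun b : J => φ b) (φ' := φ) id Subtype.val fun _ _ _ h => h) := by
  classical
  let J' : Option Y → Set Y
    | none => J
    | some b => {b}
  have h (i : Option Y) : Function.Injective (free fun b : J' i => φ b) :=
    free_injective (fun b => rank b) fun b => hrank b
  let c (b : Y) : Option Y := if b ∈ J then none else some b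
  have hc (b : Y) : b ∈ J' (c b) := by
    by_cases hb : b ∈ J <;> simp [c, J', hb]
  refine Function.Injective.of_comp (f := toPushout J' c hc) ?_
  rw [← MonoidHom.coe_comp]
  convert Monoid.PushoutI.of_injective h none
  refine hom_ext (fun a => ?_) fun ⟨b, hb⟩ => ?_
  · rw [MonoidHom.comp_apply, map_x, toPushout_x, ← Monoid.PushoutI.of_apply_eq_base _ none,
      free_of]
    rfl
  · rw [MonoidHom.comp_apply, map_y, toPushout_y]
    have hn : c b = none := if_pos hb
    have key (i : Option Y) (hi : i = none) (hbi : b ∈ J' i) :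
        (Monoid.PushoutI.of i (y ⟨b, hbi⟩) : Monoid.PushoutI fun i => free fun b : J' i => φ b) =
          Monoid.PushoutI.of none (y ⟨b, hb⟩) := by
      subst hi
      rfl
    exact key _ hn _

end Gamma

/-! ### The kernel of the retraction `G → ⟨t⟩` -/

/-- The vertex `(n, τ)` of the tree together with the conjugating power of `t`. -/
abbrev ShiftedVertex : Type := (ℕ × List ℤ) × ℤ

/-- The relations of the group generated by the conjugates `tᵐ (n, τ) t⁻ᵐ`, `tᵐ a t⁻ᵐ` and
`bⱼ`. -/
def shiftedRel : ℤ ⊕ ℤ → ShiftedVertex → Option ShiftedVertex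
  | .inl m, (v, k) => if k = m then some (parent v.1 v.2, k) else none
  | .inr j, (v, k) => some ((v.1, v.2 ++ [j - k]), k)

/-- A function increasing along the relations `shiftedRel b`. -/
def shiftedRank : ℤ ⊕ ℤ → ShiftedVertex → ℤ
  | .inl _, (v, _) => v.1 - v.2.length
  | .inr _, (v, _) => v.2.length

theorem shiftedRank_lt (b : ℤ ⊕ ℤ) (p p' : ShiftedVertex) (h : shiftedRel b p = some p') :
    shiftedRank b p < shiftedRank b p' := by
  obtain ⟨⟨n, τ⟩, k⟩ := p
  cases b with
  | inl m =>
    simp only [shiftedRel, Option.ite_none_right_eq_some, Option.some.injEq] at h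
    obtain ⟨-, rfl⟩ := h
    cases τ with
    | nil => simp [parent, shiftedRank]
    | cons c τ => simp [parent, shiftedRank]
  | inr j =>
    simp only [shiftedRel, Option.some.injEq] at h
    subst h
    simp [shiftedRank]

/-- The map of the tree into itself moving the vertices `(0, τ)` to `(1, ⟨i⟩⌢τ)`. -/
def raise (i : ℤ) : ℕ × List ℤ → ℕ × List ℤ
  | (0, τ) => (1, i :: τ)
  | (n + 1, τ) => (n + 1, τ)

theorem raise_append (i : ℤ) (n : ℕ) (τ : List ℤ) (c : ℤ) :
    raise i (n, τ ++ [c]) = ((raise i (n, τ)).1, (raise i (n, τ)).2 ++ [c]) := by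
  cases n <;> rfl

theorem parent_raise (i : ℤ) (v : ℕ × List ℤ) :
    parent (raise i v).1 (raise i v).2 = raise i (parent v.1 v.2) := by
  obtain ⟨n, τ⟩ := v
  cases n <;> cases τ <;> rfl

theorem shiftedRel_raise {i : ℤ} {b : ℤ ⊕ ℤ} {p p' : ShiftedVertex} (h : shiftedRel b p = some p') :
    shiftedRel b (raise i p.1, p.2) = some (raise i p'.1, p'.2) := by
  obtain ⟨v, k⟩ := p
  obtain m | j := b
  · simp only [shiftedRel, Option.ite_none_right_eq_some, Option.some.injEq] at h
    obtain ⟨rfl, rfl⟩ := h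
    simp [shiftedRel, parent_raise]
  · simp only [shiftedRel, Option.some.injEq] at h
    subst h
    simp [shiftedRel, raise_append]

/-- The partial inverse of `raise i`. -/
def lower (i : ℤ) : ℕ × List ℤ → ℕ × List ℤ
  | (1, c :: τ) => if c = i then (0, τ) else (1, c :: τ)
  | v => v

theorem lower_append {i : ℤ} (n : ℕ) (τ : List ℤ) {c : ℤ} (hc : c ≠ i) :
    lower i (n, τ ++ [c]) = ((lower i (n, τ)).1, (lower i (n, τ)).2 ++ [c]) := by
  match n, τ with
  | 0, _ => rfl
  | n + 2, _ => rfl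
  | 1, [] => simp [lower, hc]
  | 1, d :: τ => by_cases h : d = i <;> simp [lower, h]

theorem parent_lower (i : ℤ) (v : ℕ × List ℤ) :
    parent (lower i v).1 (lower i v).2 = lower i (parent v.1 v.2) := by
  match v with
  | (0, []) => rfl
  | (0, d :: τ) => rfl
  | (n + 2, []) => rfl
  | (n + 2, d :: τ) => rfl
  | (1, []) => rfl
  | (1, [d]) => by_cases h : d = i <;> simp [lower, h, parent]
  | (1, d :: e :: τ) => by_cases h : d = i <;> simp [lower, h, parent]

theorem lower_raise (i : ℤ) {v : ℕ × List ℤ} (hv : v.1 = 1 → v.2.head? ≠ some i) :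
    lower i (raise i v) = v := by
  match v with
  | (0, τ) => simp [raise, lower]
  | (n + 2, τ) => rfl
  | (1, []) => rfl
  | (1, d :: τ) => simpa [raise, lower] using fun h => by simp [h] at hv

/-- The subgroup of `G` generated by the conjugates of the vertices and of `a` by powers of `t`,
and by the `bⱼ`. -/
abbrev Shifted : Type := Gamma shiftedRel

/-- The endomorphism induced by `raise`. -/
def raiseHom (J : Set (ℤ ⊕ ℤ)) (i : ℤ) :
    Gamma (fun b : J => shiftedRel b) →* Gamma (fun b : J => shiftedRel b) :=
  Gamma.map (fun p => (raise i p.1, p.2)) id fun _ _ _ => shiftedRel_raise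

/-- The letters for which `lower i` induces an endomorphism acting on the conjugates of the
vertices by `tᵐ`, `m ∈ M`. -/
def lowerable (M : Finset ℤ) (i : ℤ) : Set (ℤ ⊕ ℤ) := {b | ∀ j, b = .inr j → ∀ m ∈ M, j - m ≠ i}

/-- The endomorphism induced by `lower`. -/
def lowerHom (M : Finset ℤ) (i : ℤ) : Gamma (fun b : lowerable M i => shiftedRel b) →*
    Gamma (fun b : lowerable M i => shiftedRel b) :=
  Gamma.map (fun p => if p.2 ∈ M then (lower i p.1, p.2) else p) id (by
    rintro ⟨m | j, hb⟩ ⟨v, k⟩ p' h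
    · simp only [shiftedRel, Option.ite_none_right_eq_some, Option.some.injEq] at h
      obtain ⟨rfl, rfl⟩ := h
      by_cases hk : k ∈ M <;> simp [shiftedRel, parent_lower, hk]
    · simp only [shiftedRel, Option.some.injEq] at h
      subst h
      by_cases hk : k ∈ M
      · simp [shiftedRel, lower_append _ _ (hb j rfl k hk), hk]
      · simp [shiftedRel, hk])

/-- The inclusion of the subgroup generated by the vertices and a set of letters. -/
def incl (J : Set (ℤ ⊕ ℤ)) : Gamma (fun b : J => shiftedRel b) →* Shifted :=
  Gamma.map id Subtype.val fun _ _ _ h => h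

theorem incl_injective (J : Set (ℤ ⊕ ℤ)) : Function.Injective (incl J) :=
  Gamma.map_subtype_injective shiftedRank shiftedRank_lt J

open Filter in
theorem exists_lower_raise (w : Shifted) : ∃ M₀ : Finset ℤ, ∀ M, M₀ ⊆ M → ∀ᶠ i in atTop,
    ∃ g, incl (lowerable M i) g = w ∧
      incl (lowerable M i) (lowerHom M i (raiseHom (lowerable M i) i g)) = w := by
  obtain ⟨w, rfl⟩ := PresentedGroup.mk_surjective _ w
  have hof (s : ShiftedVertex ⊕ (ℤ ⊕ ℤ)) : ∃ M₀ : Finset ℤ, ∀ M, M₀ ⊆ M → ∀ᶠ i in atTop,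
      ∃ g, incl (lowerable M i) g = PresentedGroup.of s ∧
        incl (lowerable M i) (lowerHom M i (raiseHom (lowerable M i) i g)) =
          PresentedGroup.of s := by
    obtain p | m | j := s
    · refine ⟨{p.2}, fun M hM => ?_⟩
      filter_upwards [eventually_gt_atTop (p.1.2.head?.getD 0)] with i hi
      refine ⟨Gamma.x p, Gamma.map_x _ _ _ _, ?_⟩
      have hv : p.1.1 = 1 → p.1.2.head? ≠ some i := fun _ h => by simp [h] at hi
      rw [raiseHom, lowerHom, incl, Gamma.map_x, Gamma.map_x, Gamma.map_x,
        if_pos (by simpa using hM), lower_raise i hv]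
      rfl
    · refine ⟨∅, fun M _ => Eventually.of_forall fun i => ?_⟩
      refine ⟨Gamma.y ⟨.inl m, by simp [lowerable]⟩, Gamma.map_y _ _ _ _, ?_⟩
      rw [raiseHom, lowerHom, incl, Gamma.map_y, Gamma.map_y, Gamma.map_y]
      rfl
    · refine ⟨∅, fun M _ => ?_⟩
      filter_upwards [(eventually_all_finset M).mpr fun m _ => eventually_gt_atTop (j - m)]
        with i hi
      have hj : Sum.inr j ∈ lowerable M i := by
        rintro _ ⟨⟩ m hm
        exact (hi m hm).ne
      refine ⟨Gamma.y ⟨.inr j, hj⟩, Gamma.map_y _ _ _ _, ?_⟩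
      rw [raiseHom, lowerHom, incl, Gamma.map_y, Gamma.map_y, Gamma.map_y]
      rfl
  induction w using FreeGroup.induction_on with
  | C1 => exact ⟨∅, fun M _ => Eventually.of_forall fun i => ⟨1, by simp⟩⟩
  | of s => exact hof s
  | inv_of s h =>
    obtain ⟨M₀, h⟩ := h
    refine ⟨M₀, fun M hM => (h M hM).mono fun i ⟨g, hg, hg'⟩ => ⟨g⁻¹, ?_⟩⟩
    rw [map_inv, map_inv, map_inv, map_inv, map_inv, hg, hg']
    exact ⟨rfl, rfl⟩
  | mul w w' h h' =>
    obtain ⟨M₀, h⟩ := h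
    obtain ⟨M₁, h'⟩ := h'
    refine ⟨M₀ ∪ M₁, fun M hM => ?_⟩
    filter_upwards [h M (Finset.union_subset_left hM), h' M (Finset.union_subset_right hM)]
      with i ⟨g, hg₁, hg₂⟩ ⟨g', hg₁', hg₂'⟩
    refine ⟨g * g', ?_⟩
    rw [map_mul, map_mul, map_mul, map_mul, map_mul, hg₁, hg₂, hg₁', hg₂']
    exact ⟨rfl, rfl⟩

/-- The endomorphism induced by `raise`. -/
def shiftedRaise (i : ℤ) : Shifted →* Shifted :=
  Gamma.map (fun p => (raise i p.1, p.2)) id fun _ _ _ => shiftedRel_raise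

theorem eventually_shiftedRaise (w : Shifted) :
    ∀ᶠ i in Filter.atTop, shiftedRaise i w = 1 → w = 1 := by
  obtain ⟨M, hM⟩ := exists_lower_raise w
  filter_upwards [hM M subset_rfl] with i ⟨g, hg, hg'⟩ h
  have hc : (shiftedRaise i).comp (incl (lowerable M i)) =
      (incl (lowerable M i)).comp (raiseHom (lowerable M i) i) :=
    Gamma.hom_ext (fun a => by simp [shiftedRaise, incl, raiseHom, Gamma.map_x])
      fun b => by simp [shiftedRaise, incl, raiseHom, Gamma.map_y]
  have h1 : incl _ (raiseHom (lowerable M i) i g) = 1 := by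
    rw [← h, ← hg]
    exact (DFunLike.congr_fun hc g).symm
  rw [← hg', incl_injective _ (h1.trans (map_one _).symm), map_one, map_one]

/-! ### The group `G` -/

theorem mk_uWord {α : Type} (x y : α) :
    FreeGroup.mk (uWord x y) = uElt (FreeGroup.of x) (FreeGroup.of y) := by
  have hrep (k : ℕ) : FreeGroup.mk (List.replicate k (x, true)) = FreeGroup.of x ^ k := by
    induction k with
    | zero => rfl
    | succ k ih => rw [List.replicate_succ', ← FreeGroup.mul_mk, ih, pow_succ, FreeGroup.of]
  rw [uWord, uElt]
  induction List.range 100 with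
  | nil => rfl
  | cons k l ih =>
    rw [List.flatMap_cons, ← FreeGroup.mul_mk, ih, ← FreeGroup.mul_mk, hrep, List.map_cons,
      List.prod_cons, ← FreeGroup.of]

/-- The relations satisfied by the generators of `G`. -/
structure GRelations {A : Type*} [Group A] (vert : ℕ × List ℤ → A) (a : A) (b : ℤ → A) (t : A) :
    Prop where
  uElt_a : ∀ v, uElt (vert v) a = vert (parent v.1 v.2)
  uElt_b : ∀ v i, uElt (vert v) (b i) = vert (v.1, v.2 ++ [i])
  conj_b : ∀ i, t * b i * t⁻¹ = b (i + 1)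

/-- The map of the generators of `G` with prescribed values. -/
def genMap {A : Type*} (vert : ℕ × List ℤ → A) (a : A) (b : ℤ → A) (t : A) : GGen → A
  | some (.vert n τ) => vert (n, τ)
  | some .a => a
  | some (.b i) => b i
  | none => t

theorem lift_mk_uWord {α A : Type} [Group A] (f : Option α → A) (x y z : α) :
    FreeGroup.lift f (FreeGroup.mk ((uWord x y ++ [(z, false)]).map fun p => (some p.1, p.2))) =
      uElt (f (some x)) (f (some y)) * (f (some z))⁻¹ := by
  rw [← FreeGroup.map.mk, ← FreeGroup.mul_mk, mk_uWord, map_mul, map_mul, map_uElt, map_uElt]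
  simp [FreeGroup.lift_mk, FreeGroup.map.mk]

theorem lift_genMap_eq_one_iff {A : Type} [Group A] {vert : ℕ × List ℤ → A} {a : A} {b : ℤ → A}
    {t : A} : (∀ r ∈ GRels, FreeGroup.lift (genMap vert a b t) r = 1) ↔
      GRelations vert a b t := by
  constructor
  · intro h
    refine ⟨fun v => ?_, fun v i => ?_, fun i => ?_⟩
    · have := h _ ⟨_, .inl ⟨_, .inl ⟨v.1, v.2, rfl⟩, rfl⟩, rfl⟩
      rwa [lift_mk_uWord, mul_inv_eq_one] at this
    · have := h _ ⟨_, .inl ⟨_, .inr ⟨v.1, v.2, i, rfl⟩, rfl⟩, rfl⟩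
      rwa [lift_mk_uWord, mul_inv_eq_one] at this
    · have := h _ ⟨_, .inr ⟨i, rfl⟩, rfl⟩
      rw [← mul_inv_eq_one]
      simpa [FreeGroup.lift_mk, genMap, mul_assoc] using this
  · rintro ⟨h1, h2, h3⟩ _ ⟨w, ⟨w, ⟨n, τ, hw⟩ | ⟨n, τ, i, hw⟩, rfl⟩ | ⟨i, hw⟩, rfl⟩
    · rw [hw, lift_mk_uWord, mul_inv_eq_one]
      exact h1 (n, τ)
    · rw [hw, lift_mk_uWord, mul_inv_eq_one]
      exact h2 (n, τ) i
    · have := mul_inv_eq_one.mpr (h3 i)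
      rw [hw]
      simpa [FreeGroup.lift_mk, genMap, mul_assoc] using this

/-- The vertices of the tree as elements of `G`. -/
def gvertex (v : ℕ × List ℤ) : G := gvert v.1 v.2

theorem gRelations : GRelations gvertex ga gb gt' := by
  refine lift_genMap_eq_one_iff.mp fun r hr => ?_
  have : FreeGroup.lift (genMap gvertex ga gb gt') = PresentedGroup.mk GRels := by
    ext s
    rw [FreeGroup.lift_apply_of]
    obtain _ | _ | _ | _ := s <;> rfl
  rw [this]
  exact PresentedGroup.one_of_mem hr

theorem GRelations.map {A B : Type*} [Group A] [Group B] {vert : ℕ × List ℤ → A} {a : A} {b : ℤ → A}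
    {t : A} (h : GRelations vert a b t) (f : A →* B) :
    GRelations (fun v => f (vert v)) (f a) (fun i => f (b i)) (f t) where
  uElt_a v := by rw [← map_uElt, h.uElt_a]
  uElt_b v i := by rw [← map_uElt, h.uElt_b]
  conj_b i := by rw [← map_inv, ← map_mul, ← map_mul, h.conj_b]

section gLift

variable {A : Type} [Group A] {vert : ℕ × List ℤ → A} {a : A} {b : ℤ → A} {t : A}

/-- The universal property of `G`. -/
def gLift (h : GRelations vert a b t) : G →* A :=
  PresentedGroup.toGroup (lift_genMap_eq_one_iff.mpr h)

theorem gLift_gvertex (h : GRelations vert a b t) (v : ℕ × List ℤ) : gLift h (gvertex v) = vert v :=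
  PresentedGroup.toGroup.of _

theorem gLift_ga (h : GRelations vert a b t) : gLift h ga = a :=
  PresentedGroup.toGroup.of _

theorem gLift_gb (h : GRelations vert a b t) (i : ℤ) : gLift h (gb i) = b i :=
  PresentedGroup.toGroup.of _

theorem gLift_gt' (h : GRelations vert a b t) : gLift h gt' = t :=
  PresentedGroup.toGroup.of _

theorem g_hom_ext {f g : G →* A} (hv : ∀ v, f (gvertex v) = g (gvertex v)) (ha : f ga = g ga)
    (hb : ∀ i, f (gb i) = g (gb i)) (ht : f gt' = g gt') : f = g :=
  PresentedGroup.ext fun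
    | some (.vert n τ) => hv (n, τ)
    | some .a => ha
    | some (.b i) => hb i
    | none => ht

end gLift

/-! ### `G` as a semidirect product -/

theorem gt'_zpow_conj (m j : ℤ) : gt' ^ m * gb j * (gt' ^ m)⁻¹ = gb (j + m) := by
  induction m with
  | zero => simp
  | succ m ih =>
    rw [add_comm (m : ℤ) 1, zpow_one_add, mul_inv_rev, add_comm 1, ← add_assoc,
      ← gRelations.conj_b, ← ih]
    group
  | pred m ih =>
    rw [← mul_right_inj gt', ← mul_left_inj gt'⁻¹, gRelations.conj_b, add_assoc, sub_add_cancel,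
      ← ih]
    group

/-- Conjugation by `tᵏ`. -/
def shift (k : ℤ) : Shifted →* Shifted :=
  Gamma.map (fun p => (p.1, p.2 + k)) (Sum.map (· + k) (· + k)) (by
    rintro (m | j) ⟨v, l⟩ p' h
    · simp only [shiftedRel, Option.ite_none_right_eq_some, Option.some.injEq] at h
      obtain ⟨rfl, rfl⟩ := h
      simp [shiftedRel]
    · simp only [shiftedRel, Option.some.injEq] at h
      subst h
      simp [shiftedRel])

theorem shift_x (k : ℤ) (p : ShiftedVertex) : shift k (Gamma.x p) = Gamma.x (p.1, p.2 + k) :=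
  Gamma.map_x _ _ _ _

theorem shift_y (k : ℤ) (b : ℤ ⊕ ℤ) :
    shift k (Gamma.y b) = Gamma.y (Sum.map (· + k) (· + k) b) :=
  Gamma.map_y _ _ _ _

theorem shift_zero : shift 0 = MonoidHom.id _ :=
  Gamma.hom_ext (fun p => by simp [shift_x]) fun b => by cases b <;> simp [shift_y]

theorem shift_comp_shift (k l : ℤ) : (shift k).comp (shift l) = shift (k + l) :=
  Gamma.hom_ext (fun p => by simp [shift_x, add_assoc, add_comm l])
    fun b => by cases b <;> simp [shift_y, add_assoc, add_comm l]

/-- The action of `⟨t⟩` on `Shifted`. -/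
def shiftAut : Multiplicative ℤ →* MulAut Shifted where
  toFun k := MonoidHom.toMulEquiv (shift k.toAdd) (shift (-k.toAdd))
    (by rw [shift_comp_shift, neg_add_cancel, shift_zero])
    (by rw [shift_comp_shift, add_neg_cancel, shift_zero])
  map_one' := by
    ext w
    exact DFunLike.congr_fun shift_zero w
  map_mul' k l := by
    ext w
    exact (DFunLike.congr_fun (shift_comp_shift k.toAdd l.toAdd) w).symm

theorem shiftAut_apply (k : Multiplicative ℤ) (w : Shifted) : shiftAut k w = shift k.toAdd w := rfl

/-- The homomorphism from `G` to the semidirect product of `Shifted` and `⟨t⟩`. -/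
def toSemidirect : G →* Shifted ⋊[shiftAut] Multiplicative ℤ :=
  gLift (vert := fun v => .inl (Gamma.x (v, 0))) (a := .inl (Gamma.y (.inl 0)))
    (b := fun j => .inl (Gamma.y (.inr j))) (t := .inr (.ofAdd 1))
    { uElt_a := fun v => by rw [← map_uElt, Gamma.uElt_x_y (by simp [shiftedRel]; rfl)]
      uElt_b := fun v i => by rw [← map_uElt, Gamma.uElt_x_y (by simp [shiftedRel]; rfl)]
      conj_b := fun i => by
        rw [← map_inv, ← SemidirectProduct.inl_aut, shiftAut_apply, shift_y]
        rfl }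

/-- Conjugation by a power of `t`. -/
def tConj (m : ℤ) : G →* G := (MulAut.conj (gt' ^ m)).toMonoidHom

theorem tConj_gb (m j : ℤ) : tConj m (gb j) = gb (j + m) := gt'_zpow_conj m j

theorem tConj_tConj (m k : ℤ) (g : G) : tConj m (tConj k g) = tConj (k + m) g := by
  rw [add_comm k, tConj, tConj, tConj, zpow_add, map_mul]
  rfl

/-- The homomorphism from `Shifted` to `G`. -/
def ofShifted : Shifted →* G :=
  Gamma.lift (fun p => tConj p.2 (gvertex p.1)) (Sum.elim (fun m => tConj m ga) gb) (by
    rintro (m | j) ⟨v, l⟩ p' h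
    · simp only [shiftedRel, Option.ite_none_right_eq_some, Option.some.injEq] at h
      obtain ⟨rfl, rfl⟩ := h
      exact (gRelations.map (tConj l)).uElt_a v
    · simp only [shiftedRel, Option.some.injEq] at h
      subst h
      have := (gRelations.map (tConj l)).uElt_b v (j - l)
      rwa [tConj_gb, sub_add_cancel] at this)

theorem ofShifted_x (p : ShiftedVertex) : ofShifted (Gamma.x p) = tConj p.2 (gvertex p.1) :=
  Gamma.lift_x _ _ _ _

theorem ofShifted_y (b : ℤ ⊕ ℤ) :
    ofShifted (Gamma.y b) = Sum.elim (fun m => tConj m ga) gb b :=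
  Gamma.lift_y _ _ _ _

theorem ofShifted_comp_shift (k : ℤ) :
    ofShifted.comp (shift k) = (tConj k).comp ofShifted := by
  refine Gamma.hom_ext (fun p => ?_) fun b => ?_
  · rw [MonoidHom.comp_apply, MonoidHom.comp_apply, shift_x, ofShifted_x, ofShifted_x, tConj_tConj]
  · rw [MonoidHom.comp_apply, MonoidHom.comp_apply, shift_y, ofShifted_y, ofShifted_y]
    obtain m | j := b
    · exact (tConj_tConj k m ga).symm
    · exact (tConj_gb k j).symm

/-- The left inverse of `toSemidirect`. -/
def ofSemidirect : Shifted ⋊[shiftAut] Multiplicative ℤ →* G :=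
  SemidirectProduct.lift ofShifted (zpowersHom G gt') (by
    intro k
    exact ofShifted_comp_shift k.toAdd)

theorem ofSemidirect_inl (w : Shifted) : ofSemidirect (.inl w) = ofShifted w :=
  SemidirectProduct.lift_inl _ _ _ _

theorem ofSemidirect_inr (k : ℤ) : ofSemidirect (.inr (.ofAdd k)) = gt' ^ k :=
  SemidirectProduct.lift_inr _ _ _ _

theorem toSemidirect_injective : Function.Injective toSemidirect := by
  have h : ofSemidirect.comp toSemidirect = MonoidHom.id G := by
    refine g_hom_ext (fun v => ?_) ?_ (fun i => ?_) ?_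
    · rw [MonoidHom.comp_apply, toSemidirect, gLift_gvertex, ofSemidirect_inl, ofShifted_x]
      simp [tConj]
    · rw [MonoidHom.comp_apply, toSemidirect, gLift_ga, ofSemidirect_inl, ofShifted_y]
      simp [tConj]
    · rw [MonoidHom.comp_apply, toSemidirect, gLift_gb, ofSemidirect_inl, ofShifted_y]
      rfl
    · rw [MonoidHom.comp_apply, toSemidirect, gLift_gt', ofSemidirect_inr]
      exact zpow_one _
  exact Function.LeftInverse.injective (g := ofSemidirect) fun g => DFunLike.congr_fun h g

/-! ### The retractions of `G` onto `H` -/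

/-- The retraction of `G` onto `H` induced by `raise i`. -/
def retraction (i : ℤ) : G →* G :=
  gLift (vert := fun v => gvertex (raise i v)) (a := ga) (b := gb) (t := gt')
    { uElt_a := fun v => by rw [gRelations.uElt_a, parent_raise]
      uElt_b := fun v j => by rw [gRelations.uElt_b, ← raise_append]
      conj_b := gRelations.conj_b }

theorem shiftedRaise_comp_shift (i k : ℤ) :
    (shiftedRaise i).comp (shift k) = (shift k).comp (shiftedRaise i) :=
  Gamma.hom_ext (fun p => by simp [shift_x, shiftedRaise, Gamma.map_x])
    fun b => by simp [shift_y, shiftedRaise, Gamma.map_y]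

/-- The endomorphism of the semidirect product induced by `shiftedRaise i`. -/
def semidirectRaise (i : ℤ) :
    Shifted ⋊[shiftAut] Multiplicative ℤ →* Shifted ⋊[shiftAut] Multiplicative ℤ :=
  SemidirectProduct.map (shiftedRaise i) (MonoidHom.id _) (by
    intro k
    exact shiftedRaise_comp_shift i k.toAdd)

theorem semidirectRaise_inl (i : ℤ) (w : Shifted) :
    semidirectRaise i (.inl w) = .inl (shiftedRaise i w) :=
  SemidirectProduct.map_inl _ _ _ _

theorem semidirectRaise_inr (i : ℤ) (k : Multiplicative ℤ) :
    semidirectRaise i (.inr k) = .inr k :=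
  SemidirectProduct.map_inr _ _ _ _

theorem toSemidirect_retraction (i : ℤ) (g : G) :
    toSemidirect (retraction i g) = semidirectRaise i (toSemidirect g) := by
  refine DFunLike.congr_fun (g_hom_ext (f := toSemidirect.comp (retraction i))
    (g := (semidirectRaise i).comp toSemidirect) (fun v => ?_) ?_ (fun j => ?_) ?_) g <;>
  simp [retraction, toSemidirect, gLift_gvertex, gLift_ga, gLift_gb, gLift_gt', shiftedRaise,
    Gamma.map_x, Gamma.map_y, semidirectRaise_inl, semidirectRaise_inr]

theorem eventually_retraction_ne_one {g : G} (hg : g ≠ 1) :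
    ∀ᶠ i in Filter.atTop, retraction i g ≠ 1 := by
  filter_upwards [eventually_shiftedRaise (toSemidirect g).left] with i hi h
  refine hg (toSemidirect_injective ?_)
  have := toSemidirect_retraction i g
  rw [h, map_one, SemidirectProduct.ext_iff] at this
  rw [map_one]
  exact SemidirectProduct.ext (hi this.1.symm) this.2.symm

theorem uElt_mem {A : Type*} [Group A] {L : Subgroup A} {x y : A} (hx : x ∈ L) (hy : y ∈ L) :
    uElt x y ∈ L := by
  refine list_prod_mem fun g hg => ?_
  obtain ⟨k, -, rfl⟩ := List.mem_map.mp hg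
  exact mul_mem (pow_mem hx _) hy

theorem ga_mem_H : ga ∈ H := Subgroup.subset_closure (by simp)

theorem gt'_mem_H : gt' ∈ H := Subgroup.subset_closure (by simp)

theorem gb_mem_H (i : ℤ) : gb i ∈ H := by
  rw [← zero_add i, ← gt'_zpow_conj]
  exact mul_mem (mul_mem (zpow_mem gt'_mem_H _) (Subgroup.subset_closure (by simp)))
    (inv_mem (zpow_mem gt'_mem_H _))

theorem gvertex_mem_H (n : ℕ) (τ : List ℤ) : gvertex (n + 1, τ) ∈ H := by
  induction τ using List.reverseRecOn with
  | nil =>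
    induction n with
    | zero => exact Subgroup.subset_closure (by simp [gvertex])
    | succ n ih => exact gRelations.uElt_a (n + 1, []) ▸ uElt_mem ih ga_mem_H
  | append_singleton τ c ih => exact gRelations.uElt_b (n + 1, τ) c ▸ uElt_mem ih (gb_mem_H c)

theorem retraction_of_mem (i : ℤ) {h : G} (hh : h ∈ H) : retraction i h = h := by
  refine MonoidHom.eqOn_closure (f := retraction i) (g := MonoidHom.id G) ?_ hh
  rintro _ (rfl | rfl | rfl | rfl)
  · exact gLift_gvertex _ (1, [])
  · exact gLift_ga _
  · exact gLift_gb _ 0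
  · exact gLift_gt' _

theorem range_retraction (i : ℤ) : (retraction i).range = H := by
  refine le_antisymm ?_ fun h hh => ⟨h, retraction_of_mem i hh⟩
  rw [MonoidHom.range_eq_map, ← PresentedGroup.closure_range_of, MonoidHom.map_closure,
    Subgroup.closure_le]
  rintro _ ⟨_, ⟨s, rfl⟩, rfl⟩
  obtain _ | ⟨n, τ⟩ | _ | j := s
  · exact (retraction_of_mem i gt'_mem_H).symm ▸ gt'_mem_H
  · have : retraction i (gvertex (n, τ)) ∈ H := by
      rw [retraction, gLift_gvertex]
      cases n with
      | zero => exact gvertex_mem_H 0 _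
      | succ n => exact gvertex_mem_H n τ
    exact this
  · exact (retraction_of_mem i ga_mem_H).symm ▸ ga_mem_H
  · exact (retraction_of_mem i (gb_mem_H j)).symm ▸ gb_mem_H j

/-- For every finite `S ⊆ G` with `1 ∉ S` there is a retraction `κ : G → G` onto `H`
fixing `H` pointwise with `1 ∉ κ(S)`. -/
theorem stmt4 (S : Finset G) (hS : (1 : G) ∉ S) :
    ∃ κ : G →* G, (∀ h ∈ H, κ h = h) ∧ κ.range = H ∧ ∀ s ∈ S, κ s ≠ 1 := by
  obtain ⟨i, hi⟩ := ((Filter.eventually_all_finset S).mpr fun s hs =>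
    eventually_retraction_ne_one (ne_of_mem_of_not_mem hs hS)).exists
  exact ⟨retraction i, fun _ => retraction_of_mem i, range_retraction i, hi⟩
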